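/- Let p₁(·), p₂(·) : ℝⁿ → [1,∞) satisfy 1 < (pⱼ)₋ ≤ (pⱼ)₊ < ∞ and pⱼ(·) ∈ LH for j = 1,2, define p(·) by 1/p(x) = 1/p₁(x) + 1/p₂(x), let w₁, w₂ be weights with w = w₁w₂, and assume (w₁,w₂,w) ∈ A_{p⃗(·)}. Set u(x) = w(x)^{p(x)} and σⱼ(x) = wⱼ(x)^{−pⱼ'(x)} for j = 1,2. Then there is a constant C such that for all nonnegative bounded compactly supported f₁, f₂ satisfying ∫_{ℝⁿ} fⱼ(x)^{pⱼ(x)}σⱼ(x) dx ≤ 1 for j = 1,2, one has ∫_{ℝⁿ} M^d(f₁σ₁, f₂σ₂)(x)^{p(x)} u(x) dx ≤ C, where M^d(g₁,g₂)(x) = sup over dyadic cubes Q ∈ 𝒟₀ containing x of (⨍_Q |g₁|dy)(⨍_Q |g₂|dy). -/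

import Mathlib

open MeasureTheory ENNReal Set

noncomputable section

/-- Euclidean space `ℝⁿ`. -/
abbrev Rn (n : ℕ) : Type := Fin n → ℝ

/-- A cube in `ℝⁿ` with sides parallel to the coordinate axes. -/
structure Cube (n : ℕ) : Type where
  base : Fin n → ℝ
  side : ℝ
  side_pos : 0 < side

namespace Cube

/-- The set of points of a cube. -/
def toSet {n : ℕ} (Q : Cube n) : Set (Rn n) :=
  {x | ∀ i, Q.base i ≤ x i ∧ x i < Q.base i + Q.side}

/-- The volume `|Q|` of a cube. -/
def vol {n : ℕ} (Q : Cube n) : ℝ≥0∞ := ENNReal.ofReal (Q.side ^ n)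

/-- Membership in the standard dyadic grid `𝒟₀`. -/
def IsDyadic {n : ℕ} (Q : Cube n) : Prop :=
  ∃ (k : ℤ) (j : Fin n → ℤ), Q.side = (2 : ℝ) ^ (-k) ∧
    ∀ i, Q.base i = (2 : ℝ) ^ (-k) * (j i : ℝ)

end Cube

/-- The modular associated to an extended-real-valued exponent `r(·)`:
`ρ(f/λ) = ∫_{r ≠ ∞} (f/λ)^{r(x)} dμ + ‖f/λ‖_{L^∞({r = ∞})}`. -/
def eModular {n : ℕ} (r : Rn n → ℝ≥0∞) (μ : Measure (Rn n)) (f : Rn n → ℝ≥0∞)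
    (lam : ℝ≥0∞) : ℝ≥0∞ :=
  (∫⁻ x in {x | r x ≠ ∞}, (f x / lam) ^ (r x).toReal ∂μ)
    + essSup (fun x => f x / lam) (μ.restrict {x | r x = ∞})

/-- The variable Lebesgue (quasi)norm `‖f‖_{r(·)}` with respect to a measure `μ`. -/
def eNorm {n : ℕ} (r : Rn n → ℝ≥0∞) (μ : Measure (Rn n)) (f : Rn n → ℝ≥0∞) : ℝ≥0∞ :=
  sInf {lam : ℝ≥0∞ | lam ≠ 0 ∧ eModular r μ f lam ≤ 1}

/-- The variable Lebesgue norm of a real-valued function with respect to Lebesgue measure. -/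
def vNorm {n : ℕ} (r : Rn n → ℝ≥0∞) (f : Rn n → ℝ) : ℝ≥0∞ :=
  eNorm r volume fun x => ENNReal.ofReal |f x|

/-- View a real-valued exponent as an extended-real-valued one. -/
def ofExp {n : ℕ} (p : Rn n → ℝ) : Rn n → ℝ≥0∞ := fun x => ENNReal.ofReal (p x)

/-- The conjugate of an extended real exponent: `1/t + 1/t' = 1`. -/
def econj (t : ℝ≥0∞) : ℝ≥0∞ :=
  if t = 1 then ∞ else if t = ∞ then 1 else ENNReal.ofReal (t.toReal / (t.toReal - 1))

/-- The pointwise conjugate exponent `p'(·)` of a real-valued exponent. -/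
def conjExp {n : ℕ} (p : Rn n → ℝ) : Rn n → ℝ≥0∞ := fun x => econj (ENNReal.ofReal (p x))

/-- A weight: a measurable function that is positive (and finite) a.e. -/
def IsWeight {n : ℕ} (w : Rn n → ℝ) : Prop :=
  Measurable w ∧ ∀ᵐ x ∂(volume : Measure (Rn n)), 0 < w x

/-- Local log-Hölder continuity `LH₀`. -/
def LH0 {n : ℕ} (p : Rn n → ℝ) : Prop :=
  ∃ C₀ > 0, ∀ x y : Rn n, dist x y < 1 / 2 →
    |1 / p x - 1 / p y| ≤ C₀ / (-Real.log (dist x y))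

/-- Log-Hölder continuity at infinity with a given asymptotic value `pinf`. -/
def LHinfWith {n : ℕ} (p : Rn n → ℝ) (pinf : ℝ) : Prop :=
  ∃ C > 0, ∀ x : Rn n, |1 / p x - 1 / pinf| ≤ C / Real.log (Real.exp 1 + ‖x‖)

/-- Log-Hölder continuity at infinity `LH∞`. -/
def LHinf {n : ℕ} (p : Rn n → ℝ) : Prop := ∃ pinf > 0, LHinfWith p pinf

/-- Log-Hölder continuity `LH = LH₀ ∩ LH∞`. -/
def LH {n : ℕ} (p : Rn n → ℝ) : Prop := LH0 p ∧ LHinf p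

/-- The bilinear variable Muckenhoupt condition `(w₁,w₂,w) ∈ A_{p⃗(·)}`. -/
def ApVec {n : ℕ} (p₁ p₂ p w₁ w₂ w : Rn n → ℝ) : Prop :=
  ∃ C : ℝ≥0∞, C ≠ ∞ ∧ ∀ Q : Cube n,
    Q.vol⁻¹ ^ 2 * vNorm (ofExp p) (Q.toSet.indicator w) *
      vNorm (conjExp p₁) (Q.toSet.indicator fun x => (w₁ x)⁻¹) *
      vNorm (conjExp p₂) (Q.toSet.indicator fun x => (w₂ x)⁻¹) ≤ C

/-- The variable Muckenhoupt class `A_{r(·)}` for an extended-real-valued exponent. -/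
def ApVarE {n : ℕ} (r : Rn n → ℝ≥0∞) (v : Rn n → ℝ) : Prop :=
  ∃ C : ℝ≥0∞, C ≠ ∞ ∧ ∀ Q : Cube n,
    Q.vol⁻¹ * vNorm r (Q.toSet.indicator v) *
      vNorm (fun x => econj (r x)) (Q.toSet.indicator fun x => (v x)⁻¹) ≤ C

/-- The bilinear maximal operator `M(f₁,f₂)`. -/
def biMax {n : ℕ} (f₁ f₂ : Rn n → ℝ) (x : Rn n) : ℝ≥0∞ :=
  ⨆ (Q : Cube n) (_ : x ∈ Q.toSet),
    (Q.vol⁻¹ * ∫⁻ y in Q.toSet, ENNReal.ofReal |f₁ y|) *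
      (Q.vol⁻¹ * ∫⁻ y in Q.toSet, ENNReal.ofReal |f₂ y|)

/-- The dyadic bilinear maximal operator `M^d(f₁,f₂)`. -/
def biMaxD {n : ℕ} (f₁ f₂ : Rn n → ℝ) (x : Rn n) : ℝ≥0∞ :=
  ⨆ (Q : Cube n) (_ : Q.IsDyadic) (_ : x ∈ Q.toSet),
    (Q.vol⁻¹ * ∫⁻ y in Q.toSet, ENNReal.ofReal |f₁ y|) *
      (Q.vol⁻¹ * ∫⁻ y in Q.toSet, ENNReal.ofReal |f₂ y|)

/-- The bilinear averaging operator `A_Q(f₁,f₂) = (⨍_Q f₁)(⨍_Q f₂)χ_Q`. -/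
def avgOp {n : ℕ} (Q : Cube n) (f₁ f₂ : Rn n → ℝ) (x : Rn n) : ℝ≥0∞ :=
  Q.toSet.indicator
    (fun _ =>
      (Q.vol⁻¹ * ∫⁻ y in Q.toSet, ENNReal.ofReal |f₁ y|) *
        (Q.vol⁻¹ * ∫⁻ y in Q.toSet, ENNReal.ofReal |f₂ y|)) x

/-- `(p)₋(Q)`, the essential infimum of `p` on a cube `Q`. -/
def pMinusOn {n : ℕ} (p : Rn n → ℝ) (Q : Cube n) : ℝ :=
  essInf p (volume.restrict Q.toSet)

/-- The exponent `q(Q)` with `1/q(Q) = 1/(p₁)₋(Q) + 1/(p₂)₋(Q)`. -/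
def qExp {n : ℕ} (p₁ p₂ : Rn n → ℝ) (Q : Cube n) : ℝ :=
  ((pMinusOn p₁ Q)⁻¹ + (pMinusOn p₂ Q)⁻¹)⁻¹

/-! ### Cubes and dyadic cubes -/

namespace Cube

variable {n : ℕ}

theorem toSet_eq_pi (Q : Cube n) :
    Q.toSet = Set.pi univ fun i => Ico (Q.base i) (Q.base i + Q.side) := by
  ext x; simp [toSet]

theorem measurableSet_toSet (Q : Cube n) : MeasurableSet Q.toSet := by
  rw [toSet_eq_pi]
  exact MeasurableSet.univ_pi fun i => measurableSet_Ico

theorem volume_toSet (Q : Cube n) : volume Q.toSet = ENNReal.ofReal (Q.side ^ n) := by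
  rw [toSet_eq_pi, Real.volume_pi_Ico]
  simp [ENNReal.ofReal_pow Q.side_pos.le]

theorem side_pow_pos (Q : Cube n) : 0 < Q.side ^ n := pow_pos Q.side_pos n

/-- The center of a cube. -/
def center (Q : Cube n) : Rn n := fun i => Q.base i + Q.side / 2

/-- The concentric cube of half the side length. -/
def half (Q : Cube n) : Cube n where
  base i := Q.base i + Q.side / 4
  side := Q.side / 2
  side_pos := half_pos Q.side_pos

theorem half_subset (Q : Cube n) : Q.half.toSet ⊆ Q.toSet := by
  intro x hx i
  have h := hx i
  have := Q.side_pos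
  simp only [half] at h
  constructor <;> linarith [h.1, h.2]

theorem dist_center_le (Q : Cube n) {x : Rn n} (hx : x ∈ Q.toSet) :
    dist x Q.center ≤ Q.side / 2 := by
  refine (dist_pi_le_iff (half_pos Q.side_pos).le).2 fun i => ?_
  have h := hx i
  rw [Real.dist_eq, abs_le]
  simp only [center]
  constructor <;> linarith [h.1, h.2]

/-- The dyadic cube with indices `(k, j)`. -/
def dyadic (q : ℤ × (Fin n → ℤ)) : Cube n where
  base i := (2 : ℝ) ^ (-q.1) * (q.2 i : ℝ)
  side := (2 : ℝ) ^ (-q.1)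
  side_pos := by positivity

theorem isDyadic_dyadic (q : ℤ × (Fin n → ℤ)) : (dyadic q).IsDyadic :=
  ⟨q.1, q.2, rfl, fun _ => rfl⟩

theorem IsDyadic.exists_eq {Q : Cube n} (hQ : Q.IsDyadic) : ∃ q, Q = dyadic q := by
  obtain ⟨k, j, hs, hb⟩ := hQ
  refine ⟨(k, j), ?_⟩
  obtain ⟨b, s, hs'⟩ := Q
  simp only at hs hb
  subst hs
  simp only [dyadic, Cube.mk.injEq, and_true]
  exact funext hb

theorem mem_dyadic_iff (q : ℤ × (Fin n → ℤ)) (x : Rn n) :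
    x ∈ (dyadic q).toSet ↔ ∀ i, ⌊(2 : ℝ) ^ q.1 * x i⌋ = q.2 i := by
  refine forall_congr' fun i => ?_
  have h2 : (0 : ℝ) < 2 ^ q.1 := by positivity
  have e : (2 : ℝ) ^ q.1 * 2 ^ (-q.1) = 1 := by
    rw [← zpow_add₀ two_ne_zero]; simp
  rw [Int.floor_eq_iff, ← mul_le_mul_iff_right₀ h2, ← mul_lt_mul_iff_right₀ h2]
  simp only [dyadic]
  rw [mul_add, ← mul_assoc, e, one_mul]

theorem dyadic_subset_of_le {q q' : ℤ × (Fin n → ℤ)} (hk : q.1 ≤ q'.1) {z : Rn n}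
    (hz : z ∈ (dyadic q).toSet) (hz' : z ∈ (dyadic q').toSet) :
    (dyadic q').toSet ⊆ (dyadic q).toSet := by
  intro x hx
  rw [mem_dyadic_iff] at *
  intro i
  obtain ⟨d, hd⟩ := Int.eq_ofNat_of_zero_le (sub_nonneg.2 hk)
  have key : ∀ y : ℝ, ⌊(2 : ℝ) ^ q.1 * y⌋ = ⌊(2 : ℝ) ^ q'.1 * y⌋ / ((2 ^ d : ℕ) : ℤ) := by
    intro y
    rw [← Int.floor_div_natCast]
    congr 1
    have : q'.1 = q.1 + d := by lia
    rw [this, zpow_add₀ two_ne_zero]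
    push_cast
    rw [zpow_natCast]
    field_simp
  rw [key, hx i, ← hz' i, ← key, hz i]

theorem dyadic_subset_or_subset_or_disjoint (q q' : ℤ × (Fin n → ℤ)) :
    (dyadic q).toSet ⊆ (dyadic q').toSet ∨ (dyadic q').toSet ⊆ (dyadic q).toSet ∨
      Disjoint (dyadic q).toSet (dyadic q').toSet := by
  by_cases h : Disjoint (dyadic q).toSet (dyadic q').toSet
  · exact Or.inr (Or.inr h)
  · obtain ⟨z, hz, hz'⟩ := Set.not_disjoint_iff.1 h
    rcases le_total q.1 q'.1 with hk | hk
    · exact Or.inr (Or.inl (dyadic_subset_of_le hk hz hz'))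
    · exact Or.inl (dyadic_subset_of_le hk hz' hz)

theorem IsDyadic.half_side_le_abs_center {Q : Cube n} (hQ : Q.IsDyadic) (i : Fin n) :
    Q.side / 2 ≤ |Q.center i| := by
  obtain ⟨k, j, hs, hb⟩ := hQ
  have h0 := Q.side_pos
  have : Q.center i = Q.side * (j i + 1 / 2) := by
    simp only [center, hb i, ← hs]; ring
  rw [this, abs_mul, abs_of_pos h0]
  have : (1 / 2 : ℝ) ≤ |(j i : ℝ) + 1 / 2| := by
    rcases le_or_gt 0 (j i) with h | h
    · have : (0 : ℝ) ≤ j i := by exact_mod_cast h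
      exact le_trans (by linarith) (le_abs_self _)
    · have : (j i : ℝ) ≤ -1 := by exact_mod_cast (by lia : j i ≤ -1)
      exact le_trans (by linarith) (neg_le_abs _)
  nlinarith

theorem IsDyadic.norm_le_two_mul_norm_center {Q : Cube n} (hQ : Q.IsDyadic) {x : Rn n}
    (hx : x ∈ Q.toSet) : ‖x‖ ≤ 2 * ‖Q.center‖ := by
  refine (pi_norm_le_iff_of_nonneg (by positivity)).2 fun i => ?_
  have h1 := hQ.half_side_le_abs_center i
  have h2 : |x i - Q.center i| ≤ Q.side / 2 :=
    (dist_le_pi_dist x Q.center i).trans (Q.dist_center_le hx)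
  have h3 : |Q.center i| ≤ ‖Q.center‖ := norm_le_pi_norm Q.center i
  have h4 := abs_add_le (x i - Q.center i) (Q.center i)
  rw [sub_add_cancel] at h4
  rw [Real.norm_eq_abs]
  linarith

theorem IsDyadic.eq_center_or_side_le {Q : Cube n} (hQ : Q.IsDyadic) {x : Rn n}
    (hx : x ∈ Q.half.toSet) : x = Q.center ∨ Q.side ≤ 4 * ‖x‖ := by
  rcases isEmpty_or_nonempty (Fin n) with h | ⟨⟨i⟩⟩
  · exact Or.inl (Subsingleton.elim _ _)
  · right
    have h1 := hQ.half_side_le_abs_center i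
    have h2 : |Q.center i - x i| ≤ Q.side / 4 := by
      have := hx i
      simp only [half] at this
      rw [abs_le]
      simp only [center]
      constructor <;> linarith [this.1, this.2]
    have h3 : |x i| ≤ ‖x‖ := norm_le_pi_norm x i
    have h4 := abs_add_le (Q.center i - x i) (x i)
    rw [sub_add_cancel] at h4
    linarith

/-- The quantity `e + |x| + 1 / ℓ(Q)` controlling the logarithmic modulus of continuity
of the exponents on `Q`. -/
def scale (Q : Cube n) (x : Rn n) : ℝ := Real.exp 1 + ‖x‖ + Q.side⁻¹

theorem exp_one_add_norm_le_scale (Q : Cube n) (x : Rn n) : Real.exp 1 + ‖x‖ ≤ Q.scale x := by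
  have := inv_pos.2 Q.side_pos
  simp only [scale]; linarith

theorem exp_one_le_scale (Q : Cube n) (x : Rn n) : Real.exp 1 ≤ Q.scale x :=
  le_trans (by linarith [norm_nonneg x]) (Q.exp_one_add_norm_le_scale x)

theorem one_le_scale (Q : Cube n) (x : Rn n) : 1 ≤ Q.scale x :=
  le_trans (by linarith [Real.add_one_le_exp (1 : ℝ)]) (Q.exp_one_le_scale x)

theorem one_le_log_scale (Q : Cube n) (x : Rn n) : 1 ≤ Real.log (Q.scale x) := by
  rw [Real.le_log_iff_exp_le (by linarith [Q.one_le_scale x])]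
  exact Q.exp_one_le_scale x

/-- The cube `[-R, R)ⁿ`. -/
def sym (n : ℕ) (R : ℝ) (hR : 0 < R) : Cube n where
  base _ := -R
  side := 2 * R
  side_pos := by positivity

theorem mem_sym {R : ℝ} (hR : 0 < R) {x : Rn n} (hx : ‖x‖ < R) : x ∈ (sym n R hR).toSet := by
  intro i
  have := (norm_le_pi_norm x i).trans_lt hx
  rw [Real.norm_eq_abs, abs_lt] at this
  simp only [sym]
  constructor <;> linarith [this.1, this.2]

/-- Near any of its points, a cube contains a small cube of side comparable with
`min (side, 1)`. -/
theorem exists_small_subcube (Q : Cube n) {x : Rn n} (hx : x ∈ Q.toSet) :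
    ∃ E : Cube n, E.toSet ⊆ Q.toSet ∧ (∀ y ∈ E.toSet, ‖y‖ ≤ ‖x‖ + 1) ∧
      (2 * Q.scale x ^ 2)⁻¹ ≤ E.side := by
  have hs0 := Q.side_pos
  set s := min Q.side 1 with hs
  have hs1 : 0 < s := lt_min hs0 one_pos
  have hs2 : s ≤ Q.side := min_le_left _ _
  have hs3 : s ≤ 1 := min_le_right _ _
  let E : Cube n := ⟨fun i => if x i ≤ Q.base i + Q.side / 2 then x i else x i - s / 2, s / 2,
    half_pos hs1⟩
  refine ⟨E, ?_, ?_, ?_⟩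
  · intro y hy i
    have h := hy i
    have h' := hx i
    simp only [E] at h
    split_ifs at h with hi
    · constructor <;> linarith [h.1, h.2, h'.1, h'.2]
    · push Not at hi
      constructor <;> linarith [h.1, h.2, h'.1, h'.2]
  · intro y hy
    refine (pi_norm_le_iff_of_nonneg (by positivity)).2 fun i => ?_
    have h := hy i
    have h3 : |x i| ≤ ‖x‖ := norm_le_pi_norm x i
    rw [abs_le] at h3
    rw [Real.norm_eq_abs, abs_le]
    simp only [E] at h
    split_ifs at h with hi
    · constructor <;> linarith [h.1, h.2, h3.1, h3.2]
    · constructor <;> linarith [h.1, h.2, h3.1, h3.2]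
  · have hL := Q.one_le_scale x
    have h1 : (Q.scale x)⁻¹ ≤ s := by
      refine le_min ?_ (inv_le_one_of_one_le₀ hL)
      rw [inv_le_comm₀ (by linarith) hs0]
      simp only [scale]
      linarith [norm_nonneg x, Real.exp_pos 1]
    have h2 : (Q.scale x ^ 2)⁻¹ ≤ (Q.scale x)⁻¹ := by
      apply inv_anti₀ (by linarith)
      nlinarith
    simp only [E]
    rw [mul_inv]
    linarith

end Cube

/-! ### The dyadic maximal operator with respect to a measure -/

section DyadicMaximal

variable {n : ℕ}

/-- The dyadic maximal operator with respect to the measure `μ`. -/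
def dyMax (μ : Measure (Rn n)) (g : Rn n → ℝ≥0∞) (x : Rn n) : ℝ≥0∞ :=
  ⨆ q : ℤ × (Fin n → ℤ), (Cube.dyadic q).toSet.indicator
    (fun _ => (μ (Cube.dyadic q).toSet)⁻¹ * ∫⁻ y in (Cube.dyadic q).toSet, g y ∂μ) x

theorem average_le_dyMax (μ : Measure (Rn n)) (g : Rn n → ℝ≥0∞) {Q : Cube n} (hQ : Q.IsDyadic)
    {x : Rn n} (hx : x ∈ Q.toSet) :
    (μ Q.toSet)⁻¹ * ∫⁻ y in Q.toSet, g y ∂μ ≤ dyMax μ g x := by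
  obtain ⟨q, rfl⟩ := hQ.exists_eq
  refine le_trans ?_ (le_iSup _ q)
  rw [indicator_of_mem hx]

theorem measurable_dyMax (μ : Measure (Rn n)) (g : Rn n → ℝ≥0∞) : Measurable (dyMax μ g) :=
  Measurable.iSup fun _ => measurable_const.indicator (Cube.measurableSet_toSet _)

theorem mul_measure_biUnion_dyadic_le (μ : Measure (Rn n)) (g : Rn n → ℝ≥0∞) (c : ℝ≥0∞)
    (F : Finset (ℤ × (Fin n → ℤ)))
    (hF : ∀ q ∈ F, c * μ (Cube.dyadic q).toSet ≤ ∫⁻ y in (Cube.dyadic q).toSet, g y ∂μ) :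
    c * μ (⋃ q ∈ F, (Cube.dyadic q).toSet) ≤ ∫⁻ y, g y ∂μ := by
  classical
  let A : Finset (Set (Rn n)) := F.image fun q => (Cube.dyadic q).toSet
  let G := A.filter fun s => Maximal (· ∈ A) s
  have hAG : (⋃ q ∈ F, (Cube.dyadic q).toSet) ⊆ ⋃ s ∈ G, s := by
    intro x hx
    simp only [mem_iUnion, exists_prop] at hx ⊢
    obtain ⟨q, hq, hxq⟩ := hx
    obtain ⟨s, hs, hmax⟩ := A.exists_le_maximal (Finset.mem_image_of_mem _ hq)
    exact ⟨s, Finset.mem_filter.2 ⟨hmax.1, hmax⟩, hs hxq⟩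
  have hdis : (G : Set (Set (Rn n))).PairwiseDisjoint id := by
    intro s hs t ht hst
    obtain ⟨hsA, hsm⟩ := Finset.mem_filter.1 (Finset.mem_coe.1 hs)
    obtain ⟨htA, htm⟩ := Finset.mem_filter.1 (Finset.mem_coe.1 ht)
    obtain ⟨q, -, rfl⟩ := Finset.mem_image.1 hsA
    obtain ⟨q', -, rfl⟩ := Finset.mem_image.1 htA
    rcases Cube.dyadic_subset_or_subset_or_disjoint q q' with h | h | h
    · exact absurd (hsm.eq_of_le htA h) hst
    · exact absurd (htm.eq_of_le hsA h).symm hst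
    · exact h
  have hmeas : ∀ s ∈ G, MeasurableSet s := by
    intro s hs
    obtain ⟨q, -, rfl⟩ := Finset.mem_image.1 (Finset.mem_filter.1 hs).1
    exact Cube.measurableSet_toSet _
  calc c * μ (⋃ q ∈ F, (Cube.dyadic q).toSet) ≤ c * ∑ s ∈ G, μ s := by
        gcongr
        exact (measure_mono hAG).trans (measure_biUnion_finset_le _ _)
    _ = ∑ s ∈ G, c * μ s := Finset.mul_sum _ _ _
    _ ≤ ∑ s ∈ G, ∫⁻ y in s, g y ∂μ := by
        refine Finset.sum_le_sum fun s hs => ?_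
        obtain ⟨q, hq, rfl⟩ := Finset.mem_image.1 (Finset.mem_filter.1 hs).1
        exact hF q hq
    _ = ∫⁻ y in ⋃ s ∈ G, s, g y ∂μ := (lintegral_biUnion_finset hdis hmeas g).symm
    _ ≤ ∫⁻ y, g y ∂μ := setLIntegral_le_lintegral _ _

theorem mul_measure_lt_dyMax_le (μ : Measure (Rn n)) (g : Rn n → ℝ≥0∞) (c : ℝ≥0∞) :
    c * μ {x | c < dyMax μ g x} ≤ ∫⁻ y, g y ∂μ := by
  let S : Set (ℤ × (Fin n → ℤ)) :=
    {q | c * μ (Cube.dyadic q).toSet ≤ ∫⁻ y in (Cube.dyadic q).toSet, g y ∂μ}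
  let U : Finset S → Set (Rn n) := fun F => ⋃ q ∈ F.map ⟨Subtype.val, Subtype.val_injective⟩,
    (Cube.dyadic q).toSet
  have hsub : {x | c < dyMax μ g x} ⊆ ⋃ F, U F := by
    intro x hx
    obtain ⟨q, hq⟩ := lt_iSup_iff.1 (show c < dyMax μ g x from hx)
    by_cases hxq : x ∈ (Cube.dyadic q).toSet
    · rw [indicator_of_mem hxq] at hq
      have hqS : q ∈ S := by
        have h1 : c ≤ (∫⁻ y in (Cube.dyadic q).toSet, g y ∂μ) / μ (Cube.dyadic q).toSet := by
          rw [ENNReal.div_eq_inv_mul]; exact hq.le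
        exact ENNReal.mul_le_of_le_div h1
      refine mem_iUnion.2 ⟨{⟨q, hqS⟩}, ?_⟩
      simpa [U] using And.intro hqS hxq
    · rw [indicator_of_notMem hxq] at hq
      exact absurd hq (by simp)
  have hdir : Directed (· ⊆ ·) U := by
    refine Monotone.directed_le fun F F' h => ?_
    exact biUnion_subset_biUnion_left (Finset.map_subset_map.2 h)
  calc c * μ {x | c < dyMax μ g x} ≤ c * ⨆ F, μ (U F) := by
        gcongr
        exact (measure_mono hsub).trans hdir.measure_iUnion.le
    _ = ⨆ F, c * μ (U F) := ENNReal.mul_iSup _ _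
    _ ≤ ∫⁻ y, g y ∂μ := by
        refine iSup_le fun F => mul_measure_biUnion_dyadic_le μ g c _ fun q hq => ?_
        obtain ⟨⟨q', hq'⟩, -, rfl⟩ := Finset.mem_map.1 hq
        exact hq'

theorem dyMax_le_add (μ : Measure (Rn n)) (g : Rn n → ℝ≥0∞) (c : ℝ≥0∞)
    (x : Rn n) : dyMax μ g x ≤ dyMax μ ({y | c < g y}.indicator g) x + c := by
  refine iSup_le fun q => ?_
  by_cases hx : x ∈ (Cube.dyadic q).toSet
  · rw [indicator_of_mem hx]
    have hD := Cube.measurableSet_toSet (Cube.dyadic q)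
    have h1 : ∫⁻ y in (Cube.dyadic q).toSet, g y ∂μ ≤
        (∫⁻ y in (Cube.dyadic q).toSet, {y | c < g y}.indicator g y ∂μ) +
          c * μ (Cube.dyadic q).toSet := by
      rw [← setLIntegral_const, ← lintegral_add_right _ measurable_const]
      refine lintegral_mono fun y => ?_
      by_cases hy : c < g y
      · simp [indicator, hy]
      · simpa [indicator, hy] using not_lt.1 hy
    calc _ ≤ (μ (Cube.dyadic q).toSet)⁻¹ *
          ((∫⁻ y in (Cube.dyadic q).toSet, {y | c < g y}.indicator g y ∂μ) +
          c * μ (Cube.dyadic q).toSet) := by gcongr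
      _ = (μ (Cube.dyadic q).toSet)⁻¹ *
          (∫⁻ y in (Cube.dyadic q).toSet, {y | c < g y}.indicator g y ∂μ) +
          c * ((μ (Cube.dyadic q).toSet)⁻¹ * μ (Cube.dyadic q).toSet) := by ring
      _ ≤ _ := by
        gcongr
        · exact average_le_dyMax μ _ (Cube.isDyadic_dyadic q) hx
        · calc c * ((μ (Cube.dyadic q).toSet)⁻¹ * μ (Cube.dyadic q).toSet) ≤ c * 1 := by
                gcongr
                exact ENNReal.inv_mul_le_one _
            _ = c := mul_one c
  · rw [indicator_of_notMem hx]
    exact zero_le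

theorem measure_lt_dyMax_le (μ : Measure (Rn n)) {g : Rn n → ℝ≥0∞} (hg : Measurable g) {t : ℝ}
    (ht : 0 < t) : μ {x | ENNReal.ofReal t < dyMax μ g x} ≤
      ENNReal.ofReal (2 / t) * ∫⁻ y in {y | ENNReal.ofReal (t / 2) < g y}, g y ∂μ := by
  have hsub : {x | ENNReal.ofReal t < dyMax μ g x} ⊆ {x | ENNReal.ofReal (t / 2) <
      dyMax μ ({y | ENNReal.ofReal (t / 2) < g y}.indicator g) x} := by
    intro x hx
    by_contra h
    simp only [mem_ofPred_eq, not_lt] at hx h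
    have := hx.trans_le (dyMax_le_add μ g (ENNReal.ofReal (t / 2)) x)
    refine absurd this (not_lt.2 ?_)
    calc _ ≤ ENNReal.ofReal (t / 2) + ENNReal.ofReal (t / 2) := by gcongr
      _ = ENNReal.ofReal t := by
        rw [← ENNReal.ofReal_add (by positivity) (by positivity), add_halves]
  have h := mul_measure_lt_dyMax_le μ ({y | ENNReal.ofReal (t / 2) < g y}.indicator g)
    (ENNReal.ofReal (t / 2))
  rw [lintegral_indicator (measurableSet_lt measurable_const hg)] at h
  have e : ENNReal.ofReal (2 / t) * ENNReal.ofReal (t / 2) = 1 := by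
    rw [← ENNReal.ofReal_mul (by positivity)]
    have : 2 / t * (t / 2) = 1 := by field_simp
    rw [this, ENNReal.ofReal_one]
  calc _ ≤ μ {x | ENNReal.ofReal (t / 2) <
      dyMax μ ({y | ENNReal.ofReal (t / 2) < g y}.indicator g) x} := measure_mono hsub
    _ = ENNReal.ofReal (2 / t) * (ENNReal.ofReal (t / 2) * μ {x | ENNReal.ofReal (t / 2) <
      dyMax μ ({y | ENNReal.ofReal (t / 2) < g y}.indicator g) x}) := by
        rw [← mul_assoc, e, one_mul]
    _ ≤ _ := by gcongr

/-- The dyadic maximal operator with respect to `μ` is bounded on `L^s(μ)` for `s > 1`. -/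
theorem lintegral_dyMax_rpow_le (μ : Measure (Rn n)) {s : ℝ} (hs : 1 < s) {g : Rn n → ℝ≥0∞}
    (hg : Measurable g) :
    ∫⁻ x, dyMax μ g x ^ s ∂μ ≤ ENNReal.ofReal (2 ^ s * s / (s - 1)) * ∫⁻ x, g x ^ s ∂μ := by
  have hs0 : 0 < s := by linarith
  have hs1 : 0 < s - 1 := by linarith
  by_cases htop : ∫⁻ x, g x ^ s ∂μ = ∞
  · rw [htop, ENNReal.mul_top (by
      rw [Ne, ENNReal.ofReal_eq_zero, not_le]; positivity)]
    exact le_top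
  have hfin : ∀ᵐ x ∂μ, g x < ∞ := by
    filter_upwards [ae_lt_top (hg.pow_const s) htop] with x hx
    by_contra h
    rw [not_lt, top_le_iff] at h
    rw [h, ENNReal.top_rpow_of_pos hs0] at hx
    exact absurd hx (lt_irrefl _)
  let ν := μ.withDensity g
  have hνμ : ν ≪ μ := withDensity_absolutelyContinuous μ g
  have key : ∀ T : ℕ, ∫⁻ x, (min (dyMax μ g x) T) ^ s ∂μ ≤
      ENNReal.ofReal (2 ^ s * s / (s - 1)) * ∫⁻ x, g x ^ s ∂μ := by
    intro T
    have hlt : ∀ x, min (dyMax μ g x) T < ∞ := fun x =>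
      (min_le_right _ _).trans_lt (ENNReal.natCast_lt_top T)
    have e1 : ∀ x, (min (dyMax μ g x) T) ^ s =
        ENNReal.ofReal ((min (dyMax μ g x) T).toReal ^ s) := by
      intro x
      rw [← ENNReal.ofReal_rpow_of_nonneg ENNReal.toReal_nonneg hs0.le,
        ENNReal.ofReal_toReal (hlt x).ne]
    simp_rw [e1]
    rw [lintegral_rpow_eq_lintegral_meas_lt_mul μ
      (Filter.Eventually.of_forall fun x => ENNReal.toReal_nonneg)
      ((measurable_dyMax μ g).min measurable_const).ennreal_toReal.aemeasurable hs0]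
    have step : ∀ t ∈ Ioi (0 : ℝ),
        μ {x | t < (min (dyMax μ g x) T).toReal} * ENNReal.ofReal (t ^ (s - 1)) ≤
          2 * (ν {x | t < 2 * (g x).toReal} * ENNReal.ofReal (t ^ (s - 1 - 1))) := by
      intro t ht
      have ht' : 0 < t := ht
      have h1 : μ {x | t < (min (dyMax μ g x) T).toReal} ≤
          μ {x | ENNReal.ofReal t < dyMax μ g x} := by
        refine measure_mono fun x hx => ?_
        exact ((ENNReal.ofReal_lt_iff_lt_toReal ht'.le (hlt x).ne).2 hx).trans_le (min_le_left _ _)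
      have h2 : ∫⁻ y in {y | ENNReal.ofReal (t / 2) < g y}, g y ∂μ =
          ν {x | t < 2 * (g x).toReal} := by
        rw [← withDensity_apply _ (measurableSet_lt measurable_const hg)]
        refine measure_congr ?_
        filter_upwards [hνμ.ae_le hfin] with x hx
        refine propext ?_
        change ENNReal.ofReal (t / 2) < g x ↔ t < 2 * (g x).toReal
        rw [ENNReal.ofReal_lt_iff_lt_toReal (by positivity) hx.ne]
        constructor <;> intro h <;> linarith
      have h3 : ENNReal.ofReal (2 / t) * ENNReal.ofReal (t ^ (s - 1)) =
          2 * ENNReal.ofReal (t ^ (s - 1 - 1)) := by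
        rw [← ENNReal.ofReal_mul (by positivity), Real.rpow_sub_one ht'.ne' (s - 1),
          ← ENNReal.ofReal_ofNat 2, ← ENNReal.ofReal_mul (by positivity)]
        congr 1
        ring
      calc _ ≤ (ENNReal.ofReal (2 / t) * ν {x | t < 2 * (g x).toReal}) *
            ENNReal.ofReal (t ^ (s - 1)) := by
            gcongr
            exact h1.trans (h2 ▸ measure_lt_dyMax_le μ hg ht')
        _ = (ENNReal.ofReal (2 / t) * ENNReal.ofReal (t ^ (s - 1))) *
            ν {x | t < 2 * (g x).toReal} := by ring
        _ = _ := by rw [h3]; ring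
    have hlc := lintegral_rpow_eq_lintegral_meas_lt_mul ν (f := fun x => 2 * (g x).toReal)
      (Filter.Eventually.of_forall fun x => by positivity)
      (hg.ennreal_toReal.const_mul 2).aemeasurable hs1
    have hν : ∫⁻ x, ENNReal.ofReal ((2 * (g x).toReal) ^ (s - 1)) ∂ν =
        ENNReal.ofReal (2 ^ (s - 1)) * ∫⁻ x, g x ^ s ∂μ := by
      rw [lintegral_withDensity_eq_lintegral_mul μ hg (by fun_prop),
        ← lintegral_const_mul _ (hg.pow_const s)]
      refine lintegral_congr_ae ?_
      filter_upwards [hfin] with x hx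
      rw [Pi.mul_apply]
      generalize g x = b at hx
      lift b to NNReal using hx.ne with a
      rw [ENNReal.coe_toReal]
      rw [Real.mul_rpow two_pos.le a.coe_nonneg, ENNReal.ofReal_mul (by positivity),
        ← ENNReal.ofReal_rpow_of_nonneg a.coe_nonneg hs1.le, ENNReal.ofReal_coe_nnreal]
      have : (a : ℝ≥0∞) ^ s = a ^ (s - 1) * a := by
        conv_lhs => rw [← sub_add_cancel s 1,
          ENNReal.rpow_add_of_nonneg _ _ hs1.le zero_le_one, ENNReal.rpow_one]
      rw [this]; ring
    calc _ ≤ ENNReal.ofReal s * ∫⁻ t in Ioi (0 : ℝ),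
          2 * (ν {x | t < 2 * (g x).toReal} * ENNReal.ofReal (t ^ (s - 1 - 1))) := by
          gcongr 1
          exact setLIntegral_mono' measurableSet_Ioi step
      _ = ENNReal.ofReal (2 * s / (s - 1)) * (ENNReal.ofReal (s - 1) * ∫⁻ t in Ioi (0 : ℝ),
          ν {x | t < 2 * (g x).toReal} * ENNReal.ofReal (t ^ (s - 1 - 1))) := by
          rw [lintegral_const_mul' _ _ (by simp), ← mul_assoc, ← mul_assoc,
            ← ENNReal.ofReal_mul (by positivity), ← ENNReal.ofReal_ofNat 2,
            ← ENNReal.ofReal_mul (by positivity)]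
          congr 2
          field_simp
      _ = _ := by
          rw [← hlc, hν, ← mul_assoc, ← ENNReal.ofReal_mul (by positivity)]
          congr 2
          rw [Real.rpow_sub_one two_ne_zero]
          ring
  have hsup : ∀ x, dyMax μ g x ^ s = ⨆ T : ℕ, (min (dyMax μ g x) T) ^ s := by
    intro x
    have h1 : dyMax μ g x = ⨆ T : ℕ, min (dyMax μ g x) T := by
      have h := inf_iSup_eq (dyMax μ g x) (fun T : ℕ => (T : ℝ≥0∞))
      rw [ENNReal.iSup_natCast, inf_top_eq] at h
      exact h
    conv_lhs => rw [h1]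
    exact (ENNReal.orderIsoRpow s hs0).map_iSup _
  simp_rw [hsup]
  rw [lintegral_iSup]
  · exact iSup_le key
  · exact fun T => (((measurable_dyMax μ g).min measurable_const).pow_const s)
  · intro T T' h x
    dsimp only
    gcongr

end DyadicMaximal

/-! ### Log-Hölder continuity relative to dyadic cubes -/

section LogRegular

variable {n : ℕ}

/-- If `0 ≤ d ≲ 1 / log L` and `t` is at most polynomial in `L`, then `t ^ d` is bounded. -/
theorem rpow_le_exp_of_log {t L A k C d : ℝ} (ht : 0 < t) (hL : 1 ≤ Real.log L) (hL0 : 0 < L)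
    (hA : 1 ≤ A) (hk : 0 ≤ k) (hd : 0 ≤ d) (hdC : d * Real.log L ≤ C) (htA : t ≤ A * L ^ k) :
    t ^ d ≤ Real.exp ((Real.log A + k) * C) := by
  rw [Real.rpow_def_of_pos ht, Real.exp_le_exp]
  have hA0 : 0 < A := by linarith
  have hlA : 0 ≤ Real.log A := Real.log_nonneg hA
  have h1 : Real.log t ≤ Real.log A + k * Real.log L := by
    have := Real.log_le_log ht htA
    rwa [Real.log_mul hA0.ne' (by positivity), Real.log_rpow hL0] at this
  have h2 : Real.log t ≤ (Real.log A + k) * Real.log L := by nlinarith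
  calc Real.log t * d ≤ (Real.log A + k) * Real.log L * d := by gcongr
    _ = (Real.log A + k) * (d * Real.log L) := by ring
    _ ≤ _ := by gcongr

theorem rpow_le_exp_of_log_of_inv {t L A k C d : ℝ} (ht : 0 < t) (hL : 1 ≤ Real.log L)
    (hL0 : 0 < L) (hA : 1 ≤ A) (hk : 0 ≤ k) (hd : d ≤ 0) (hdC : -d * Real.log L ≤ C)
    (htA : t⁻¹ ≤ A * L ^ k) : t ^ d ≤ Real.exp ((Real.log A + k) * C) := by
  have := rpow_le_exp_of_log (inv_pos.2 ht) hL hL0 hA hk (neg_nonneg.2 hd) hdC htA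
  rwa [Real.inv_rpow ht.le, Real.rpow_neg ht.le, inv_inv] at this

theorem rpow_le_exp_of_abs_log {t L A k C d : ℝ} (ht : 0 < t) (hL : 1 ≤ Real.log L)
    (hL0 : 0 < L) (hA : 1 ≤ A) (hk : 0 ≤ k) (hdC : |d| * Real.log L ≤ C)
    (htA : t ≤ A * L ^ k) (htA' : t⁻¹ ≤ A * L ^ k) :
    t ^ d ≤ Real.exp ((Real.log A + k) * C) := by
  rcases le_total 0 d with h | h
  · exact rpow_le_exp_of_log ht hL hL0 hA hk h (by rwa [abs_of_nonneg h] at hdC) htA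
  · exact rpow_le_exp_of_log_of_inv ht hL hL0 hA hk h (by rwa [abs_of_nonpos h] at hdC) htA'

/-- On every dyadic cube `Q`, the function `r` differs from its value at the center of `Q` by at
most a multiple of `1 / log (e + |x| + 1 / ℓ(Q))`. -/
def LogRegular (r : Rn n → ℝ) : Prop :=
  ∃ C, ∀ Q : Cube n, Q.IsDyadic → ∀ x ∈ Q.toSet,
    |r x - r Q.center| * Real.log (Q.scale x) ≤ C

theorem LogRegular.add {r s : Rn n → ℝ} (hr : LogRegular r) (hs : LogRegular s) :
    LogRegular fun x => r x + s x := by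
  obtain ⟨C, hC⟩ := hr
  obtain ⟨D, hD⟩ := hs
  refine ⟨C + D, fun Q hQ x hx => ?_⟩
  have h1 := hC Q hQ x hx
  have h2 := hD Q hQ x hx
  have h3 : |r x + s x - (r Q.center + s Q.center)| ≤ |r x - r Q.center| + |s x - s Q.center| := by
    rw [add_sub_add_comm]; exact abs_add_le _ _
  have := Q.one_le_log_scale x
  nlinarith

theorem LogRegular.const_sub {r : Rn n → ℝ} (hr : LogRegular r) (c : ℝ) :
    LogRegular fun x => c - r x := by
  obtain ⟨C, hC⟩ := hr
  refine ⟨C, fun Q hQ x hx => ?_⟩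
  have e : c - r x - (c - r Q.center) = -(r x - r Q.center) := by ring
  rw [e, abs_neg]
  exact hC Q hQ x hx

theorem LogRegular.inv {r : Rn n → ℝ} (hr : LogRegular r) {m : ℝ} (hm : 0 < m)
    (hmr : ∀ x, m ≤ r x) : LogRegular fun x => (r x)⁻¹ := by
  obtain ⟨C, hC⟩ := hr
  refine ⟨C / m ^ 2, fun Q hQ x hx => ?_⟩
  have h1 : 0 < r x := hm.trans_le (hmr x)
  have h2 : 0 < r Q.center := hm.trans_le (hmr _)
  have h := hC Q hQ x hx
  have hl := Q.one_le_log_scale x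
  have h3 : m ^ 2 ≤ r x * r Q.center := by
    rw [sq]; exact mul_le_mul (hmr x) (hmr _) hm.le h1.le
  have e : (r x)⁻¹ - (r Q.center)⁻¹ = (r Q.center - r x) / (r x * r Q.center) := by
    field_simp
  rw [e, abs_div, abs_of_pos (mul_pos h1 h2), abs_sub_comm, div_mul_eq_mul_div]
  exact div_le_div₀ (le_trans (by positivity) h) h (by positivity) h3

theorem LH.logRegular_inv {p : Rn n → ℝ} (hp : LH p) : LogRegular fun x => (p x)⁻¹ := by
  obtain ⟨⟨C₀, hC₀, h0⟩, pinf, -, C₁, hC₁, h1⟩ := hp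
  refine ⟨2 * C₀ + 6 * C₁, fun Q hQ x hx => ?_⟩
  have hs := Q.side_pos
  have hx0 := norm_nonneg x
  have he : 1 < Real.exp 1 := by simp
  have he2 : 2 ≤ Real.exp 1 := by linarith [Real.add_one_le_exp (1 : ℝ)]
  have hlx : 1 ≤ Real.log (Real.exp 1 + ‖x‖) := by
    rw [Real.le_log_iff_exp_le (by linarith)]; linarith
  have hΔ : |(p x)⁻¹ - (p Q.center)⁻¹| ≤ 3 * C₁ / Real.log (Real.exp 1 + ‖x‖) := by
    have hlc : Real.log (Real.exp 1 + ‖x‖) ≤ 2 * Real.log (Real.exp 1 + ‖Q.center‖) := by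
      rw [← Real.log_rpow (by positivity)]
      apply Real.log_le_log (by positivity)
      have := hQ.norm_le_two_mul_norm_center hx
      norm_num
      nlinarith [norm_nonneg Q.center]
    have a1 := h1 x
    have a2 := h1 Q.center
    have a3 : C₁ / Real.log (Real.exp 1 + ‖Q.center‖) ≤
        2 * C₁ / Real.log (Real.exp 1 + ‖x‖) := by
      rw [div_le_div_iff₀ (by linarith) (by linarith)]
      nlinarith
    rw [one_div, one_div] at a1 a2
    calc |(p x)⁻¹ - (p Q.center)⁻¹| ≤ |(p x)⁻¹ - pinf⁻¹| + |pinf⁻¹ - (p Q.center)⁻¹| :=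
          abs_sub_le _ _ _
      _ ≤ C₁ / Real.log (Real.exp 1 + ‖x‖) + 2 * C₁ / Real.log (Real.exp 1 + ‖x‖) := by
          rw [abs_sub_comm pinf⁻¹]; linarith
      _ = _ := by ring
  by_cases hcase : Q.side⁻¹ ≤ Real.exp 1 + ‖x‖
  · have hl : Real.log (Q.scale x) ≤ 2 * Real.log (Real.exp 1 + ‖x‖) := by
      rw [← Real.log_rpow (by positivity)]
      apply Real.log_le_log (by linarith [Q.one_le_scale x])
      simp only [Cube.scale]
      norm_num
      nlinarith
    calc _ ≤ 3 * C₁ / Real.log (Real.exp 1 + ‖x‖) * (2 * Real.log (Real.exp 1 + ‖x‖)) := by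
          gcongr
          linarith [Q.one_le_log_scale x]
      _ = 6 * C₁ := by field_simp; ring
      _ ≤ _ := by linarith
  · push Not at hcase
    rcases eq_or_ne x Q.center with rfl | hne
    · simp; positivity
    have hd := Q.dist_center_le hx
    have hd0 : 0 < dist x Q.center := dist_pos.2 hne
    have hinv : 2 < Q.side⁻¹ := by linarith
    have hside : Q.side < 1 / 2 := by
      rw [one_div]; exact (lt_inv_comm₀ hs two_pos).2 hinv
    have a1 := h0 x Q.center (by linarith)
    have hl1 : Real.log Q.side⁻¹ ≤ -Real.log (dist x Q.center) := by
      rw [← Real.log_inv]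
      exact Real.log_le_log (by positivity) (inv_anti₀ hd0 (by linarith))
    have hl2 : Real.log (Q.scale x) ≤ 2 * Real.log Q.side⁻¹ := by
      rw [← Real.log_rpow (by positivity)]
      apply Real.log_le_log (by linarith [Q.one_le_scale x])
      simp only [Cube.scale]
      norm_num only [Real.rpow_ofNat]
      nlinarith
    have hl0 : 0 < Real.log Q.side⁻¹ := Real.log_pos (by linarith)
    rw [one_div, one_div] at a1
    calc _ ≤ C₀ / Real.log Q.side⁻¹ * (2 * Real.log Q.side⁻¹) := by
          gcongr
          · linarith [Q.one_le_log_scale x]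
          · exact a1.trans (by gcongr)
      _ = 2 * C₀ := by rw [mul_left_comm, div_mul_cancel₀ _ hl0.ne']
      _ ≤ _ := by linarith

theorem LH0.continuous_inv {p : Rn n → ℝ} (hp : LH0 p) : Continuous fun x => (p x)⁻¹ := by
  obtain ⟨C₀, hC₀, h0⟩ := hp
  rw [Metric.continuous_iff]
  intro x ε hε
  refine ⟨min (1 / 2) (Real.exp (-(C₀ / ε + 1))), by positivity, fun y hy => ?_⟩
  rcases eq_or_ne y x with rfl | hne
  · simpa using hε
  have hd0 : 0 < dist y x := dist_pos.2 hne
  have h := h0 y x (hy.trans_le (min_le_left _ _))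
  have hl : C₀ / ε + 1 < -Real.log (dist y x) := by
    have := Real.log_lt_log hd0 (hy.trans_le (min_le_right _ _))
    rw [Real.log_exp] at this
    linarith
  rw [one_div, one_div] at h
  have hpos : 0 < C₀ / ε := by positivity
  rw [Real.dist_eq]
  refine h.trans_lt ?_
  rw [div_lt_iff₀ (by linarith)]
  have : C₀ / ε * ε = C₀ := by field_simp
  nlinarith

theorem LH0.forall_of_ae {p : Rn n → ℝ} (hp : LH0 p) (hp1 : ∀ x, 1 ≤ p x) {a b : ℝ} (ha : 1 < a)
    (h : ∀ᵐ x ∂(volume : Measure (Rn n)), a ≤ p x ∧ p x ≤ b) : ∀ x, a ≤ p x ∧ p x ≤ b := by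
  have hd := Measure.dense_of_ae h
  have hb : 0 < b := by
    obtain ⟨x, hx⟩ := h.exists
    linarith [hx.1, hx.2]
  have hset : {x | a ≤ p x ∧ p x ≤ b} = (fun x => (p x)⁻¹) ⁻¹' Icc b⁻¹ a⁻¹ := by
    ext x
    have hx := hp1 x
    simp only [mem_ofPred_eq, mem_preimage, mem_Icc]
    rw [inv_le_inv₀ hb (by linarith), inv_le_inv₀ (by linarith) (by linarith), and_comm]
  have hc : IsClosed {x | a ≤ p x ∧ p x ≤ b} := by
    rw [hset]; exact isClosed_Icc.preimage hp.continuous_inv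
  intro x
  have := hd x
  rwa [hc.closure_eq] at this

end LogRegular

/-! ### Bilinear Muckenhoupt triples -/

/-- A symmetric form of the bilinear variable Muckenhoupt condition. The three exponents `r i` stand
for `p, p₁', p₂'`, the three densities `ω i` for `u, σ₁, σ₂`, and `N i Q` for an upper bound of the
corresponding norm of the characteristic function of `Q`. -/
structure MuckenhouptTriple {n : ℕ} (r ω : Fin 3 → Rn n → ℝ) (N : Fin 3 → Cube n → ℝ)
    (m M K : ℝ) : Prop where
  measurable_exponent : ∀ i, Measurable (r i)
  measurable_density : ∀ i, Measurable (ω i)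
  density_pos : ∀ i x, 0 < ω i x
  lower_pos : 0 < m
  lower_le : ∀ i x, m ≤ r i x
  le_upper : ∀ i x, r i x ≤ M
  sum_inv : ∀ x, ∑ i, (r i x)⁻¹ = 2
  prod_rpow : ∀ x, ∏ i, ω i x ^ (r i x)⁻¹ = 1
  norm_pos : ∀ i Q, 0 < N i Q
  modular_le : ∀ i Q, ∫⁻ y in Q.toSet, ENNReal.ofReal (N i Q ^ (-r i y) * ω i y) ≤ 1
  one_le_const : 1 ≤ K
  prod_le : ∀ Q, ∏ i, N i Q ≤ K * (Q.side ^ n) ^ 2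
  logRegular : ∀ i, LogRegular (r i)

namespace MuckenhouptTriple

variable {n : ℕ} {r ω : Fin 3 → Rn n → ℝ} {N : Fin 3 → Cube n → ℝ} {m M K : ℝ}

theorem exponent_pos (h : MuckenhouptTriple r ω N m M K) (i : Fin 3) (x : Rn n) : 0 < r i x :=
  h.lower_pos.trans_le (h.lower_le i x)

theorem prod_rpow_half (h : MuckenhouptTriple r ω N m M K) {t : Fin 3 → ℝ} (ht : ∀ i, 0 < t i)
    (y : Rn n) : ∏ i, (t i ^ (-r i y) * ω i y) ^ ((r i y)⁻¹ / 2) = (∏ i, t i) ^ (-(1 / 2) : ℝ) := by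
  have h1 : ∀ i, (t i ^ (-r i y) * ω i y) ^ ((r i y)⁻¹ / 2) =
      t i ^ (-(1 / 2) : ℝ) * (ω i y ^ (r i y)⁻¹) ^ (1 / 2 : ℝ) := by
    intro i
    have hr := h.exponent_pos i y
    rw [Real.mul_rpow (by have := ht i; positivity) (h.density_pos i y).le,
      ← Real.rpow_mul (ht i).le, ← Real.rpow_mul (h.density_pos i y).le]
    congr 2
    · field_simp
    · ring
  simp_rw [h1]
  rw [Finset.prod_mul_distrib, Real.finsetProd_rpow _ _ fun i _ => (ht i).le,
    Real.finsetProd_rpow _ _ fun i _ => (Real.rpow_pos_of_pos (h.density_pos i y) _).le,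
    h.prod_rpow, Real.one_rpow, mul_one]

theorem measurable_normalized (h : MuckenhouptTriple r ω N m M K) (i : Fin 3) (t : ℝ) :
    Measurable fun y => ENNReal.ofReal (t ^ (-r i y) * ω i y) :=
  (((measurable_const.pow (h.measurable_exponent i).neg)).mul
    (h.measurable_density i)).ennreal_ofReal

/-- The product of the three norms controls the square of the volume of a cube. -/
theorem side_pow_sq_le_prod (h : MuckenhouptTriple r ω N m M K) {t : Fin 3 → ℝ} (ht : ∀ i, 0 < t i)
    (E : Cube n) (hE : ∀ i, ∫⁻ y in E.toSet, ENNReal.ofReal (t i ^ (-r i y) * ω i y) ≤ 1) :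
    (E.side ^ n) ^ 2 ≤ 9 * ∏ i, t i := by
  have hP : 0 < ∏ i, t i := Finset.prod_pos fun i _ => ht i
  have hpt : ∀ y, (∏ i, t i) ^ (-(1 / 2) : ℝ) ≤ ∑ i, t i ^ (-r i y) * ω i y := by
    intro y
    have hs : ∀ i, 0 < t i ^ (-r i y) * ω i y := fun i =>
      mul_pos (Real.rpow_pos_of_pos (ht i) _) (h.density_pos i y)
    have hw : ∀ i ∈ Finset.univ, 0 ≤ (r i y)⁻¹ / 2 := fun i _ => by
      have := h.exponent_pos i y; positivity
    have hsum : ∑ i, (r i y)⁻¹ / 2 = 1 := by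
      rw [← Finset.sum_div, h.sum_inv]; norm_num
    rw [← h.prod_rpow_half ht y]
    refine (Real.geom_mean_le_arith_mean_weighted _ _ _ hw hsum fun i _ => (hs i).le).trans ?_
    refine Finset.sum_le_sum fun i hi => ?_
    have : (r i y)⁻¹ / 2 ≤ 1 := hsum ▸ Finset.single_le_sum hw hi
    exact mul_le_of_le_one_left (hs i).le this
  have hint : ENNReal.ofReal ((∏ i, t i) ^ (-(1 / 2) : ℝ)) * ENNReal.ofReal (E.side ^ n) ≤ 3 := by
    rw [← E.volume_toSet, ← setLIntegral_const]
    calc _ ≤ ∫⁻ y in E.toSet, ∑ i, ENNReal.ofReal (t i ^ (-r i y) * ω i y) := by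
          refine lintegral_mono fun y => ?_
          rw [← ENNReal.ofReal_sum_of_nonneg fun i _ =>
            mul_nonneg (Real.rpow_pos_of_pos (ht i) _).le (h.density_pos i y).le]
          exact ENNReal.ofReal_le_ofReal (hpt y)
      _ = ∑ i, ∫⁻ y in E.toSet, ENNReal.ofReal (t i ^ (-r i y) * ω i y) :=
          lintegral_finsetSum _ fun i _ => h.measurable_normalized i (t i)
      _ ≤ ∑ i : Fin 3, 1 := Finset.sum_le_sum fun i _ => hE i
      _ = 3 := by simp
  rw [← ENNReal.ofReal_mul (by positivity), ENNReal.ofReal_le_iff_le_toReal (by simp),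
    Real.rpow_neg hP.le, ← Real.sqrt_eq_rpow, ENNReal.toReal_ofNat,
    inv_mul_le_iff₀ (Real.sqrt_pos.2 hP)] at hint
  calc (E.side ^ n) ^ 2 ≤ (√(∏ i, t i) * 3) ^ 2 := by
        have := E.side_pow_pos; gcongr
    _ = _ := by rw [mul_pow, Real.sq_sqrt hP.le]; ring

theorem side_pow_sq_le (h : MuckenhouptTriple r ω N m M K) {T : Fin 3 → ℝ} (hT : ∀ i, 0 < T i)
    {E : Cube n} (hE : ∀ i, ∫⁻ y in E.toSet, ENNReal.ofReal (T i ^ (-r i y) * ω i y) ≤ 1)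
    {i : Fin 3} {t B : ℝ} (ht : 0 < t)
    (hEt : ∫⁻ y in E.toSet, ENNReal.ofReal (t ^ (-r i y) * ω i y) ≤ 1) (hB : ∀ i, T i ≤ B) :
    (E.side ^ n) ^ 2 ≤ 9 * (t * B ^ 2) := by
  have h1 := h.side_pow_sq_le_prod (t := Function.update T i t) (fun a => by
    rcases eq_or_ne a i with rfl | ha
    · simpa
    · simpa [ha] using hT a) E (fun a => by
    rcases eq_or_ne a i with rfl | ha
    · simpa
    · simpa [ha] using hE a)
  rw [Finset.prod_update_of_mem (Finset.mem_univ i)] at h1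
  have h2 : ∏ a ∈ Finset.univ \ {i}, T a ≤ B ^ 2 := by
    have := Finset.prod_le_prod (s := Finset.univ \ {i}) (fun a _ => (hT a).le) fun a _ => hB a
    rwa [Finset.prod_const, Finset.card_sdiff_of_subset (by simp), Finset.card_univ,
      Fintype.card_fin, Finset.card_singleton] at this
  refine h1.trans ?_
  gcongr

theorem norm_le (h : MuckenhouptTriple r ω N m M K) {Q : Cube n} {B : ℝ}
    (hB : ∀ i, (N i Q)⁻¹ ≤ B) (i : Fin 3) : N i Q ≤ K * (Q.side ^ n) ^ 2 * B ^ 2 := by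
  have h1 := h.prod_le Q
  rw [← Finset.mul_prod_erase _ _ (Finset.mem_univ i)] at h1
  have hP : 0 < ∏ a ∈ Finset.univ.erase i, N a Q := Finset.prod_pos fun a _ => h.norm_pos a Q
  have h2 : (∏ a ∈ Finset.univ.erase i, N a Q)⁻¹ ≤ B ^ 2 := by
    have := Finset.prod_le_prod (s := Finset.univ.erase i)
      (fun a _ => (inv_pos.2 (h.norm_pos a Q)).le) fun a _ => hB a
    rwa [Finset.prod_const, Finset.card_erase_of_mem (by simp), Finset.card_univ,
      Fintype.card_fin, Finset.prod_inv_distrib] at this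
  have hK := h.one_le_const
  have hs := Q.side_pow_pos
  calc N i Q ≤ K * (Q.side ^ n) ^ 2 / ∏ a ∈ Finset.univ.erase i, N a Q := by
        rwa [le_div_iff₀ hP]
    _ ≤ _ := by rw [div_eq_mul_inv]; gcongr

theorem lintegral_normalized_mono (h : MuckenhouptTriple r ω N m M K) (i : Fin 3) {E Q : Cube n}
    (hEQ : E.toSet ⊆ Q.toSet) :
    ∫⁻ y in E.toSet, ENNReal.ofReal (N i Q ^ (-r i y) * ω i y) ≤ 1 :=
  (lintegral_mono_set hEQ).trans (h.modular_le i Q)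

/-- The norms grow at most polynomially on large symmetric cubes. -/
theorem exists_norm_sym_le (h : MuckenhouptTriple r ω N m M K) :
    ∃ C, 1 ≤ C ∧ ∀ i R, ∀ hR : 1 ≤ R,
      N i (Cube.sym n R (by linarith)) ≤ C * R ^ (2 * n) := by
  set Q₁ := Cube.sym n 1 one_pos with hQ₁
  set B := ∑ i, N i Q₁ with hB
  have hB0 : 0 < B := Finset.sum_pos (fun i _ => h.norm_pos i Q₁) (by simp)
  have hNB : ∀ i, N i Q₁ ≤ B := fun i =>
    Finset.single_le_sum (f := fun i => N i Q₁) (fun i _ => (h.norm_pos i Q₁).le) (by simp)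
  refine ⟨max 1 (K * (2 ^ n) ^ 2 * (9 * B ^ 2) ^ 2), le_max_left _ _, fun i R hR => ?_⟩
  set Q := Cube.sym n R (by linarith) with hQ
  have hsub : Q₁.toSet ⊆ Q.toSet := by
    intro x hx a
    have := hx a
    simp only [hQ₁, hQ, Cube.sym] at this ⊢
    constructor <;> linarith [this.1, this.2]
  have hlow : ∀ a, (N a Q)⁻¹ ≤ 9 * B ^ 2 := by
    intro a
    have h1 := h.side_pow_sq_le (fun i => h.norm_pos i Q₁) (fun i => h.modular_le i Q₁)
      (h.norm_pos a Q) (h.lintegral_normalized_mono a hsub) hNB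
    have h2 : (1 : ℝ) ≤ (Q₁.side ^ n) ^ 2 := by
      refine one_le_pow₀ (one_le_pow₀ ?_)
      simp [hQ₁, Cube.sym]
    rw [inv_le_iff_one_le_mul₀ (h.norm_pos a Q)]
    linarith
  refine (h.norm_le hlow i).trans ?_
  have e : K * (Q.side ^ n) ^ 2 * (9 * B ^ 2) ^ 2 =
      K * (2 ^ n) ^ 2 * (9 * B ^ 2) ^ 2 * R ^ (2 * n) := by
    simp only [hQ, Cube.sym]; ring
  rw [e]
  have : 0 ≤ R := by linarith
  gcongr
  exact le_max_right _ _

/-- Norms and measures of cubes cannot be smaller than a negative power of the scale. -/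
theorem exists_inv_le_scale (h : MuckenhouptTriple r ω N m M K) :
    ∃ (C : ℝ) (k : ℕ), 1 ≤ C ∧ ∀ i (Q : Cube n), ∀ x ∈ Q.toSet, ∀ t, 0 < t →
      ∫⁻ y in Q.toSet, ENNReal.ofReal (t ^ (-r i y) * ω i y) ≤ 1 → t⁻¹ ≤ C * Q.scale x ^ k := by
  obtain ⟨C, hC1, hC⟩ := h.exists_norm_sym_le
  refine ⟨9 * C ^ 2 * 4 ^ n, 8 * n, ?_, fun i Q x hx t ht hint => ?_⟩
  · have h1 : (1 : ℝ) ≤ C ^ 2 := one_le_pow₀ hC1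
    have h2 : (1 : ℝ) ≤ 4 ^ n := one_le_pow₀ (by norm_num)
    nlinarith
  obtain ⟨E, hEQ, hEx, hEs⟩ := Q.exists_small_subcube hx
  have hR : 1 ≤ ‖x‖ + 2 := by linarith [norm_nonneg x]
  have hL := Q.one_le_scale x
  have hRL : ‖x‖ + 2 ≤ Q.scale x := by
    have := Q.exp_one_add_norm_le_scale x
    linarith [Real.add_one_le_exp (1 : ℝ)]
  set S := Cube.sym n (‖x‖ + 2) (by linarith) with hS
  have hES : E.toSet ⊆ S.toSet := fun y hy => Cube.mem_sym _ (by linarith [hEx y hy])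
  have hB : ∀ a, N a S ≤ C * Q.scale x ^ (2 * n) := fun a => (hC a _ hR).trans (by gcongr)
  have h1 := h.side_pow_sq_le (fun a => h.norm_pos a S)
    (fun a => h.lintegral_normalized_mono a hES) ht ((lintegral_mono_set hEQ).trans hint) hB
  have h2 : (((2 * Q.scale x ^ 2)⁻¹) ^ n) ^ 2 ≤ (E.side ^ n) ^ 2 := by
    gcongr
  have h3 := h2.trans h1
  rw [inv_pow, inv_pow, inv_le_iff_one_le_mul₀ (by positivity)] at h3
  rw [inv_le_iff_one_le_mul₀ ht]
  refine h3.trans_eq ?_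
  have h4 : (4 : ℝ) ^ n = 2 ^ (2 * n) := by rw [pow_mul]; norm_num
  rw [h4]
  ring

theorem lintegral_density_pos (h : MuckenhouptTriple r ω N m M K) (i : Fin 3) (Q : Cube n) :
    0 < ∫⁻ y in Q.toSet, ENNReal.ofReal (ω i y) := by
  rw [setLIntegral_pos_iff (h.measurable_density i).ennreal_ofReal]
  have : Function.support (fun y => ENNReal.ofReal (ω i y)) = univ := by
    ext y; simpa using h.density_pos i y
  rw [this, univ_inter, Q.volume_toSet]
  simpa using Q.side_pow_pos

theorem lintegral_density_le (h : MuckenhouptTriple r ω N m M K) (i : Fin 3) (Q : Cube n) {B : ℝ}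
    (hB1 : 1 ≤ B) (hB : N i Q ≤ B) :
    ∫⁻ y in Q.toSet, ENNReal.ofReal (ω i y) ≤ ENNReal.ofReal (B ^ M) := by
  calc _ ≤ ∫⁻ y in Q.toSet, ENNReal.ofReal (B ^ M) *
        ENNReal.ofReal (N i Q ^ (-r i y) * ω i y) := by
        refine lintegral_mono fun y => ?_
        rw [← ENNReal.ofReal_mul (by positivity)]
        refine ENNReal.ofReal_le_ofReal ?_
        have h0 := h.norm_pos i Q
        have h1 : N i Q ^ r i y ≤ B ^ M :=
          (Real.rpow_le_rpow h0.le hB (h.exponent_pos i y).le).trans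
            (Real.rpow_le_rpow_of_exponent_le hB1 (h.le_upper i y))
        have h2 := h.density_pos i y
        calc ω i y = N i Q ^ r i y * (N i Q ^ (-r i y) * ω i y) := by
              rw [← mul_assoc, ← Real.rpow_add h0]; simp
          _ ≤ _ := by gcongr
    _ = ENNReal.ofReal (B ^ M) * ∫⁻ y in Q.toSet, ENNReal.ofReal (N i Q ^ (-r i y) * ω i y) :=
        lintegral_const_mul _ (h.measurable_normalized i _)
    _ ≤ _ := mul_le_of_le_one_right' (h.modular_le i Q)

theorem lintegral_density_ne_top (h : MuckenhouptTriple r ω N m M K) (i : Fin 3) (Q : Cube n) :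
    ∫⁻ y in Q.toSet, ENNReal.ofReal (ω i y) ≠ ∞ :=
  ne_top_of_le_ne_top ENNReal.ofReal_ne_top
    (h.lintegral_density_le i Q (le_max_left 1 (N i Q)) (le_max_right _ _))

theorem upper_pos (h : MuckenhouptTriple r ω N m M K) : 0 < M :=
  (h.exponent_pos 0 0).trans_le (h.le_upper 0 0)

theorem exists_inv_lintegral_density_le (h : MuckenhouptTriple r ω N m M K) :
    ∃ (C k : ℝ), 1 ≤ C ∧ 0 ≤ k ∧ ∀ i (Q : Cube n), ∀ x ∈ Q.toSet,
      (∫⁻ y in Q.toSet, ENNReal.ofReal (ω i y)).toReal⁻¹ ≤ C * Q.scale x ^ k := by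
  obtain ⟨C, k, hC1, hC⟩ := h.exists_inv_le_scale
  have hM := h.upper_pos
  refine ⟨C ^ M, k * M, Real.one_le_rpow hC1 hM.le, by positivity, fun i Q x hx => ?_⟩
  have hS0 := ENNReal.toReal_pos (h.lintegral_density_pos i Q).ne' (h.lintegral_density_ne_top i Q)
  have hSt := ENNReal.ofReal_toReal (h.lintegral_density_ne_top i Q)
  set S := (∫⁻ y in Q.toSet, ENNReal.ofReal (ω i y)).toReal with hS
  have hL := Q.one_le_scale x
  have hb : 1 ≤ C ^ M * Q.scale x ^ (k * M) :=
    one_le_mul_of_one_le_of_one_le (Real.one_le_rpow hC1 hM.le)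
      (Real.one_le_rpow hL (by positivity))
  rcases le_total 1 S with h1 | h1
  · exact (inv_le_one_of_one_le₀ h1).trans hb
  have ht : 0 < S ^ M⁻¹ := by positivity
  have key := hC i Q x hx (S ^ M⁻¹) ht ?_
  · have := Real.rpow_le_rpow (by positivity) key hM.le
    rwa [Real.inv_rpow ht.le, ← Real.rpow_mul hS0.le, inv_mul_cancel₀ hM.ne', Real.rpow_one,
      Real.mul_rpow (by positivity) (by positivity), ← Real.rpow_natCast,
      ← Real.rpow_mul (by positivity)] at this
  · calc _ ≤ ∫⁻ y in Q.toSet, ENNReal.ofReal S⁻¹ * ENNReal.ofReal (ω i y) := by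
          refine lintegral_mono fun y => ?_
          rw [← ENNReal.ofReal_mul (by positivity)]
          refine ENNReal.ofReal_le_ofReal ?_
          have h2 := h.density_pos i y
          gcongr
          rw [← Real.rpow_mul hS0.le, ← Real.rpow_neg_one S]
          apply Real.rpow_le_rpow_of_exponent_ge hS0 h1
          rw [mul_neg, neg_le_neg_iff, inv_mul_le_iff₀ hM, mul_one]
          exact h.le_upper i y
      _ = ENNReal.ofReal S⁻¹ * ENNReal.ofReal S := by
          rw [lintegral_const_mul _ (h.measurable_density i).ennreal_ofReal, hSt]
      _ = 1 := by
          rw [← ENNReal.ofReal_mul (by positivity), inv_mul_cancel₀ hS0.ne', ENNReal.ofReal_one]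
      _ ≤ 1 := le_rfl

end MuckenhouptTriple

/-! ### Comparison of norms and measures of dyadic cubes -/

section Decay

variable {n : ℕ}

/-- A polynomially decaying function. -/
def decay (k : ℕ) (y : Rn n) : ℝ := ((Real.exp 1 + ‖y‖) ^ k)⁻¹

theorem decay_pos (k : ℕ) (y : Rn n) : 0 < decay k y := by
  unfold decay; positivity

theorem decay_le_one (k : ℕ) (y : Rn n) : decay k y ≤ 1 := by
  refine inv_le_one_of_one_le₀ (one_le_pow₀ ?_)
  linarith [norm_nonneg y, Real.add_one_le_exp (1 : ℝ)]

theorem measurable_decay (k : ℕ) : Measurable (decay (n := n) k) :=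
  ((measurable_const.add measurable_norm).pow_const k).inv

theorem inv_decay_le_scale (k : ℕ) (Q : Cube n) (y : Rn n) : (decay k y)⁻¹ ≤ Q.scale y ^ k := by
  unfold decay
  rw [inv_inv]
  gcongr
  exact Q.exp_one_add_norm_le_scale y

end Decay

namespace MuckenhouptTriple

variable {n : ℕ} {r ω : Fin 3 → Rn n → ℝ} {N : Fin 3 → Cube n → ℝ} {m M K : ℝ}

theorem exists_lintegral_density_mul_decay_le (h : MuckenhouptTriple r ω N m M K) :
    ∃ (k : ℕ) (C : ℝ), 0 < C ∧ ∀ i,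
      ∫⁻ y, ENNReal.ofReal (ω i y * decay k y) ≤ ENNReal.ofReal C := by
  obtain ⟨C, hC1, hC⟩ := h.exists_norm_sym_le
  have hM := h.upper_pos
  obtain ⟨k, hk⟩ := exists_nat_ge ((2 * n : ℕ) * M)
  have hgrow : ∀ i (j : ℕ), ∫⁻ y in (Cube.sym n ((j : ℝ) + 1) (by positivity)).toSet,
      ENNReal.ofReal (ω i y) ≤ ENNReal.ofReal (C ^ M * ((j : ℝ) + 1) ^ k) := by
    intro i j
    have hj : (1 : ℝ) ≤ (j : ℝ) + 1 := by linarith [(Nat.cast_nonneg j : (0 : ℝ) ≤ j)]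
    refine (h.lintegral_density_le i _ (one_le_mul_of_one_le_of_one_le hC1 (one_le_pow₀ hj))
      (hC i _ hj)).trans (ENNReal.ofReal_le_ofReal ?_)
    rw [Real.mul_rpow (by positivity) (by positivity), ← Real.rpow_natCast,
      ← Real.rpow_mul (by positivity), ← Real.rpow_natCast (_ + 1) k]
    gcongr
  have hsum : Summable fun j : ℕ => C ^ M * (((j : ℝ) + 1) ^ 2)⁻¹ := by
    have := (summable_nat_add_iff 1).2 (Real.summable_nat_pow_inv.2 (one_lt_two))
    push_cast at this
    exact this.mul_left _
  refine ⟨k + 2, (∑' j : ℕ, C ^ M * (((j : ℝ) + 1) ^ 2)⁻¹) + 1, ?_, fun i => ?_⟩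
  · have : 0 ≤ ∑' j : ℕ, C ^ M * (((j : ℝ) + 1) ^ 2)⁻¹ := tsum_nonneg fun j => by positivity
    linarith
  let F : ℕ → Rn n → ℝ≥0∞ := fun j =>
    (Cube.sym n ((j : ℝ) + 1) (by positivity)).toSet.indicator fun y =>
      ENNReal.ofReal (((j : ℝ) + 1) ^ (k + 2))⁻¹ * ENNReal.ofReal (ω i y)
  have hmeas := (h.measurable_density i).ennreal_ofReal
  calc ∫⁻ y, ENNReal.ofReal (ω i y * decay (k + 2) y) ≤ ∫⁻ y, ∑' j, F j y := by
        refine lintegral_mono fun y => le_trans ?_ (ENNReal.le_tsum ⌊‖y‖⌋₊)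
        have hy := Nat.lt_floor_add_one ‖y‖
        have hy' := Nat.floor_le (norm_nonneg y)
        simp only [F]
        rw [indicator_of_mem (Cube.mem_sym _ hy), ← ENNReal.ofReal_mul (by positivity),
          mul_comm (ω i y)]
        refine ENNReal.ofReal_le_ofReal ?_
        have h0 := h.density_pos i y
        unfold decay
        have : (⌊‖y‖⌋₊ : ℝ) + 1 ≤ Real.exp 1 + ‖y‖ := by linarith [Real.add_one_le_exp (1 : ℝ)]
        gcongr
    _ = ∑' j, ∫⁻ y, F j y :=
        lintegral_tsum fun j => ((hmeas.const_mul _).indicator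
          (Cube.measurableSet_toSet _)).aemeasurable
    _ ≤ ∑' j : ℕ, ENNReal.ofReal (C ^ M * (((j : ℝ) + 1) ^ 2)⁻¹) := by
        refine ENNReal.tsum_le_tsum fun j => ?_
        simp only [F]
        rw [lintegral_indicator (Cube.measurableSet_toSet _), lintegral_const_mul _ hmeas]
        calc _ ≤ ENNReal.ofReal (((j : ℝ) + 1) ^ (k + 2))⁻¹ *
              ENNReal.ofReal (C ^ M * ((j : ℝ) + 1) ^ k) := by gcongr; exact hgrow i j
          _ = _ := by
            rw [← ENNReal.ofReal_mul (by positivity)]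
            congr 1
            have : (0 : ℝ) < (j : ℝ) + 1 := by positivity
            field_simp
            ring
    _ = ENNReal.ofReal (∑' j : ℕ, C ^ M * (((j : ℝ) + 1) ^ 2)⁻¹) :=
        (ENNReal.ofReal_tsum_of_nonneg (fun j => by positivity) hsum).symm
    _ ≤ _ := ENNReal.ofReal_le_ofReal (by linarith)

theorem exists_abs_sub_mul_log_le (h : MuckenhouptTriple r ω N m M K) :
    ∃ D, ∀ i (Q : Cube n), Q.IsDyadic → ∀ x ∈ Q.toSet,
      |r i x - r i Q.center| * Real.log (Q.scale x) ≤ D := by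
  choose D hD using h.logRegular
  refine ⟨∑ i, |D i|, fun i Q hQ x hx => (hD i Q hQ x hx).trans ((le_abs_self _).trans ?_)⟩
  exact Finset.single_le_sum (f := fun i => |D i|) (fun i _ => abs_nonneg _) (Finset.mem_univ i)

/-- Where the norm of a dyadic cube is polynomially bounded, the variation of the exponent does not
matter. -/
theorem exists_norm_rpow_sub_le (h : MuckenhouptTriple r ω N m M K) {B l : ℝ}
    (hl : 0 ≤ l) : ∃ C, 0 < C ∧ ∀ i (Q : Cube n), Q.IsDyadic → ∀ x ∈ Q.toSet,
      N i Q ≤ B * Q.scale x ^ l →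
        N i Q ^ (r i x - r i Q.center) ≤ C ∧ N i Q ^ (r i Q.center - r i x) ≤ C := by
  obtain ⟨D, hD⟩ := h.exists_abs_sub_mul_log_le
  obtain ⟨A, k, hA1, hA⟩ := h.exists_inv_le_scale
  refine ⟨Real.exp ((Real.log (max A B) + (k + l)) * D), Real.exp_pos _,
    fun i Q hQ x hx hN => ?_⟩
  have hL := Q.one_le_scale x
  have h0 := h.norm_pos i Q
  have e1 : N i Q ≤ max A B * Q.scale x ^ (k + l) := by
    refine hN.trans ?_
    gcongr
    · exact le_max_right _ _
    · linarith [(Nat.cast_nonneg k : (0 : ℝ) ≤ k)]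
  have e2 : (N i Q)⁻¹ ≤ max A B * Q.scale x ^ (k + l) := by
    refine (hA i Q x hx _ h0 (h.modular_le i Q)).trans ?_
    rw [← Real.rpow_natCast]
    gcongr
    · exact le_max_left _ _
    · linarith
  have hm : 1 ≤ max A B := hA1.trans (le_max_left _ _)
  have hd := hD i Q hQ x hx
  constructor
  · exact rpow_le_exp_of_abs_log h0 (Q.one_le_log_scale x) (by linarith) hm (by positivity) hd
      e1 e2
  · exact rpow_le_exp_of_abs_log h0 (Q.one_le_log_scale x) (by linarith) hm (by positivity)
      (by rwa [abs_sub_comm]) e1 e2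

theorem exists_lintegral_density_le_norm_rpow (h : MuckenhouptTriple r ω N m M K) :
    ∃ C, 0 < C ∧ ∀ i (Q : Cube n), Q.IsDyadic →
      ∫⁻ y in Q.toSet, ENNReal.ofReal (ω i y) ≤ ENNReal.ofReal (C * N i Q ^ r i Q.center) := by
  obtain ⟨k, T, hT, hdecay⟩ := h.exists_lintegral_density_mul_decay_le
  have hm := h.lower_pos
  obtain ⟨C, hC0, hC⟩ := h.exists_norm_rpow_sub_le (B := 1) (l := k / m) (by positivity)
  refine ⟨C + T, by positivity, fun i Q hQ => ?_⟩
  have h0 := h.norm_pos i Q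
  set ρ := r i Q.center with hρ
  have hP : 0 < N i Q ^ ρ := Real.rpow_pos_of_pos h0 _
  have hpt : ∀ y ∈ Q.toSet, ω i y ≤
      N i Q ^ ρ * (C * (N i Q ^ (-r i y) * ω i y) + ω i y * decay k y) := by
    intro y hy
    have hω := h.density_pos i y
    have hs : 0 < N i Q ^ (-r i y) := Real.rpow_pos_of_pos h0 _
    have hd := decay_pos k y
    by_cases hcase : 1 ≤ N i Q ^ ρ * decay k y
    · calc ω i y ≤ N i Q ^ ρ * decay k y * ω i y := le_mul_of_one_le_left hω.le hcase
        _ ≤ _ := by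
          have : 0 ≤ N i Q ^ ρ * (C * (N i Q ^ (-r i y) * ω i y)) := by positivity
          nlinarith
    · push Not at hcase
      have hNρ : N i Q ^ ρ ≤ Q.scale y ^ k := by
        rw [← lt_div_iff₀ hd, one_div] at hcase
        exact hcase.le.trans (inv_decay_le_scale k Q y)
      have hL := Q.one_le_scale y
      have hN : N i Q ≤ 1 * Q.scale y ^ (k / m) := by
        rw [one_mul]
        rcases le_total (N i Q) 1 with h1 | h1
        · exact h1.trans (Real.one_le_rpow hL (by positivity))
        · have : N i Q ^ m ≤ Q.scale y ^ (k : ℝ) := by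
            rw [Real.rpow_natCast]
            exact (Real.rpow_le_rpow_of_exponent_le h1 (h.lower_le i _)).trans hNρ
          have := Real.rpow_le_rpow (by positivity) this (inv_pos.2 hm).le
          rwa [← Real.rpow_mul h0.le, mul_inv_cancel₀ hm.ne', Real.rpow_one,
            ← Real.rpow_mul (by linarith), ← div_eq_mul_inv] at this
      have h2 := (hC i Q hQ y hy hN).1
      calc ω i y = N i Q ^ ρ * (N i Q ^ (r i y - ρ) * (N i Q ^ (-r i y) * ω i y)) := by
            rw [← mul_assoc, ← mul_assoc, ← Real.rpow_add h0, ← Real.rpow_add h0]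
            simp
        _ ≤ N i Q ^ ρ * (C * (N i Q ^ (-r i y) * ω i y)) := by gcongr
        _ ≤ _ := by
          gcongr
          have : 0 < ω i y * decay k y := by positivity
          linarith
  have hm1 := h.measurable_normalized i (N i Q)
  calc _ ≤ ∫⁻ y in Q.toSet, ENNReal.ofReal (N i Q ^ ρ) *
        (ENNReal.ofReal C * ENNReal.ofReal (N i Q ^ (-r i y) * ω i y) +
          ENNReal.ofReal (ω i y * decay k y)) := by
        refine setLIntegral_mono' Q.measurableSet_toSet fun y hy => ?_
        have hω := h.density_pos i y
        have hs : 0 < N i Q ^ (-r i y) := Real.rpow_pos_of_pos h0 _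
        have hd := decay_pos k y
        rw [← ENNReal.ofReal_mul hC0.le, ← ENNReal.ofReal_add (by positivity) (by positivity),
          ← ENNReal.ofReal_mul hP.le]
        exact ENNReal.ofReal_le_ofReal (hpt y hy)
    _ = ENNReal.ofReal (N i Q ^ ρ) * (ENNReal.ofReal C *
          (∫⁻ y in Q.toSet, ENNReal.ofReal (N i Q ^ (-r i y) * ω i y)) +
          ∫⁻ y in Q.toSet, ENNReal.ofReal (ω i y * decay k y)) := by
        rw [lintegral_const_mul, lintegral_add_left, lintegral_const_mul]
        · exact hm1
        · exact hm1.const_mul _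
        · exact (hm1.const_mul _).add
            ((h.measurable_density i).mul (measurable_decay k)).ennreal_ofReal
    _ ≤ ENNReal.ofReal (N i Q ^ ρ) * (ENNReal.ofReal C * 1 + ENNReal.ofReal T) := by
        gcongr
        · exact h.modular_le i Q
        · exact (setLIntegral_le_lintegral _ _).trans (hdecay i)
    _ = _ := by
        rw [mul_one, ← ENNReal.ofReal_add hC0.le hT.le, ← ENNReal.ofReal_mul hP.le, mul_comm]

end MuckenhouptTriple

/-! ### The interaction of the densities -/

theorem rpow_mul_rpow_mul_rpow_le {a b c X α x y z : ℝ} (ha : 0 < a) (hb : 0 < b) (hc : 0 < c)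
    (hX : 0 < X) (hα : 0 ≤ α) (hx : α ≤ x) (hy : α ≤ y) (hz : 0 ≤ z) (hxyz : x + y + z = 1) :
    a ^ x * b ^ y * c ^ z ≤ X ^ (2 * α) * (√(a * b) / X + (a + b + c)) := by
  have hG : 0 < √(a * b) / X := by positivity
  set G := √(a * b) / X with hGdef
  set S := G + (a + b + c) with hS
  have hS0 : 0 < S := by positivity
  have h1 : a ^ α * b ^ α = X ^ (2 * α) * G ^ (2 * α) := by
    rw [← Real.mul_rpow hX.le hG.le, hGdef, mul_div_cancel₀ _ hX.ne', Real.rpow_mul (by positivity),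
      Real.rpow_two, Real.sq_sqrt (by positivity), Real.mul_rpow ha.le hb.le]
  calc a ^ x * b ^ y * c ^ z = a ^ α * b ^ α * (a ^ (x - α) * b ^ (y - α) * c ^ z) := by
        have e1 : a ^ x = a ^ α * a ^ (x - α) := by rw [← Real.rpow_add ha]; ring_nf
        have e2 : b ^ y = b ^ α * b ^ (y - α) := by rw [← Real.rpow_add hb]; ring_nf
        rw [e1, e2]; ring
    _ ≤ X ^ (2 * α) * S ^ (2 * α) * (S ^ (x - α) * S ^ (y - α) * S ^ z) := by
        rw [h1]
        gcongr <;> linarith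
    _ = X ^ (2 * α) * S ^ (2 * α + (x - α) + (y - α) + z) := by
        rw [Real.rpow_add hS0, Real.rpow_add hS0, Real.rpow_add hS0]; ring
    _ = X ^ (2 * α) * S := by
        rw [show 2 * α + (x - α) + (y - α) + z = 1 by linarith, Real.rpow_one]

namespace MuckenhouptTriple

variable {n : ℕ} {r ω : Fin 3 → Rn n → ℝ} {N : Fin 3 → Cube n → ℝ} {m M K : ℝ}

theorem exists_le_of_lintegral_half_le (h : MuckenhouptTriple r ω N m M K) :
    ∃ c, 0 < c ∧ ∀ i, i ≠ 0 → ∀ (Q : Cube n) (X : ℝ), 0 < X →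
      ∫⁻ y in Q.half.toSet, ENNReal.ofReal
        √(N i Q ^ (-r i y) * ω i y * (N 0 Q ^ (-r 0 y) * ω 0 y)) ≤ ENNReal.ofReal X → c ≤ X := by
  have hM := h.upper_pos
  have hK := h.one_le_const
  set D := 4 * 2 ^ n * √K with hD
  have hD0 : 0 < D := by positivity
  refine ⟨(D⁻¹) ^ M, by positivity, fun i hi Q X hX hint => ?_⟩
  obtain ⟨j, hprod, hsum⟩ : ∃ j, (∀ f : Fin 3 → ℝ, ∏ a, f a = f i * f 0 * f j) ∧
      ∀ f : Fin 3 → ℝ, ∑ a, f a = f i + f 0 + f j := by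
    obtain rfl | rfl : i = 1 ∨ i = 2 := by lia
    · exact ⟨2, fun f => by rw [Fin.prod_univ_three]; ring, fun f => by rw [Fin.sum_univ_three]; ring⟩
    · exact ⟨1, fun f => by rw [Fin.prod_univ_three]; ring, fun f => by rw [Fin.sum_univ_three]; ring⟩
  set s : Fin 3 → Rn n → ℝ := fun a y => N a Q ^ (-r a y) * ω a y with hs
  have hs0 : ∀ a y, 0 < s a y := fun a y =>
    mul_pos (Real.rpow_pos_of_pos (h.norm_pos a Q) _) (h.density_pos a y)
  have hP : 0 < ∏ a, N a Q := Finset.prod_pos fun a _ => h.norm_pos a Q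
  have hpt : ∀ y, (∏ a, N a Q) ^ (-(1 / 2) : ℝ) ≤
      X ^ M⁻¹ * (√(s i y * s 0 y) / X + ∑ a, s a y) := by
    intro y
    have hlow : ∀ a, M⁻¹ / 2 ≤ (r a y)⁻¹ / 2 := fun a => by
      have := h.exponent_pos a y
      have := h.le_upper a y
      gcongr
    have hone : (r i y)⁻¹ / 2 + (r 0 y)⁻¹ / 2 + (r j y)⁻¹ / 2 = 1 := by
      have := h.sum_inv y
      rw [hsum] at this
      linarith
    rw [← h.prod_rpow_half (fun a => h.norm_pos a Q) y, hprod, hsum]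
    have := rpow_mul_rpow_mul_rpow_le (hs0 i y) (hs0 0 y) (hs0 j y) hX
      (by positivity) (hlow i) (hlow 0) (le_trans (by positivity) (hlow j)) hone
    rwa [mul_div_cancel₀ _ two_ne_zero] at this
  have hmG : Measurable fun y => ENNReal.ofReal √(s i y * s 0 y) := by
    have : ∀ a, Measurable (s a) := fun a =>
      (measurable_const.pow (h.measurable_exponent a).neg).mul (h.measurable_density a)
    exact ((this i).mul (this 0)).sqrt.ennreal_ofReal
  have hXM : 0 < X ^ M⁻¹ := by positivity
  have hI : ENNReal.ofReal ((∏ a, N a Q) ^ (-(1 / 2) : ℝ)) *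
      ENNReal.ofReal (Q.half.side ^ n) ≤ ENNReal.ofReal (X ^ M⁻¹ * 4) := by
    rw [← Q.half.volume_toSet, ← setLIntegral_const]
    calc _ ≤ ∫⁻ y in Q.half.toSet, ENNReal.ofReal (X ^ M⁻¹) * (ENNReal.ofReal X⁻¹ *
          ENNReal.ofReal √(s i y * s 0 y) + ∑ a, ENNReal.ofReal (s a y)) := by
          refine lintegral_mono fun y => ?_
          rw [← ENNReal.ofReal_sum_of_nonneg fun a _ => (hs0 a y).le,
            ← ENNReal.ofReal_mul (by positivity), ← ENNReal.ofReal_add (by positivity)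
              (Finset.sum_nonneg fun a _ => (hs0 a y).le), ← ENNReal.ofReal_mul hXM.le]
          refine ENNReal.ofReal_le_ofReal ((hpt y).trans_eq ?_)
          rw [div_eq_inv_mul]
      _ = ENNReal.ofReal (X ^ M⁻¹) * (ENNReal.ofReal X⁻¹ *
          (∫⁻ y in Q.half.toSet, ENNReal.ofReal √(s i y * s 0 y)) +
            ∑ a, ∫⁻ y in Q.half.toSet, ENNReal.ofReal (s a y)) := by
          rw [lintegral_const_mul, lintegral_add_left, lintegral_const_mul _ hmG,
            lintegral_finsetSum]
          · exact fun a _ => h.measurable_normalized a _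
          · exact hmG.const_mul _
          · exact (hmG.const_mul _).add
              (Finset.measurable_fun_sum _ fun a _ => h.measurable_normalized a _)
      _ ≤ ENNReal.ofReal (X ^ M⁻¹) * (ENNReal.ofReal X⁻¹ * ENNReal.ofReal X +
            ∑ a : Fin 3, 1) := by
          gcongr with a
          exact h.lintegral_normalized_mono a Q.half_subset
      _ = _ := by
          rw [← ENNReal.ofReal_mul (by positivity), inv_mul_cancel₀ hX.ne',
            ENNReal.ofReal_mul hXM.le]
          norm_num
  rw [← ENNReal.ofReal_mul (by positivity), ENNReal.ofReal_le_ofReal_iff (by positivity),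
    Real.rpow_neg hP.le, ← Real.sqrt_eq_rpow, inv_mul_le_iff₀ (Real.sqrt_pos.2 hP)] at hI
  have hsq : √(∏ a, N a Q) ≤ √K * Q.side ^ n := by
    rw [← Real.sqrt_sq Q.side_pow_pos.le, ← Real.sqrt_mul (by linarith)]
    exact Real.sqrt_le_sqrt (h.prod_le Q)
  have hQ := Q.side_pow_pos
  have h1 : 1 ≤ D * X ^ M⁻¹ := by
    have e : Q.half.side ^ n = Q.side ^ n / 2 ^ n := by simp [Cube.half, div_pow]
    rw [e, div_le_iff₀ (by positivity)] at hI
    have : Q.side ^ n ≤ √K * Q.side ^ n * (X ^ M⁻¹ * 4) * 2 ^ n :=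
      hI.trans (by gcongr)
    have : Q.side ^ n * 1 ≤ Q.side ^ n * (D * X ^ M⁻¹) := by
      rw [hD]; linarith
    exact le_of_mul_le_mul_left this hQ
  have h2 : D⁻¹ ≤ X ^ M⁻¹ := by rwa [inv_le_iff_one_le_mul₀' hD0]
  have := Real.rpow_le_rpow (by positivity) h2 hM.le
  rwa [← Real.rpow_mul hX.le, inv_mul_cancel₀ hM.ne', Real.rpow_one] at this

/-- The norms of a dyadic cube are controlled by the geometric mean of two of the densities. -/
theorem exists_sqrt_norm_le_lintegral (h : MuckenhouptTriple r ω N m M K) :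
    ∃ C, 0 < C ∧ ∀ i, i ≠ 0 → ∀ (Q : Cube n), Q.IsDyadic →
      ENNReal.ofReal √(N i Q ^ r i Q.center * N 0 Q ^ r 0 Q.center) ≤
        ENNReal.ofReal C * ∫⁻ y in Q.toSet, ENNReal.ofReal √(ω i y * ω 0 y) := by
  obtain ⟨c, hc0, hc⟩ := h.exists_le_of_lintegral_half_le
  obtain ⟨A, k, hA1, hA⟩ := h.exists_inv_le_scale
  have hK := h.one_le_const
  obtain ⟨C, hC0, hC⟩ := h.exists_norm_rpow_sub_le (B := K * (4 ^ n) ^ 2 * A ^ 2)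
    (l := (2 * n + 2 * k : ℕ)) (by positivity)
  have hhalf : ∀ i (Q : Cube n), Q.IsDyadic → ∀ y ∈ Q.half.toSet,
      N i Q ^ (-r i y) ≤ max C 1 * N i Q ^ (-r i Q.center) := by
    intro i Q hQ y hy
    have h0 := h.norm_pos i Q
    have hyQ := Q.half_subset hy
    have hL := Q.one_le_scale y
    have hsc : N i Q ^ (r i Q.center - r i y) ≤ max C 1 := by
      rcases hQ.eq_center_or_side_le hy with rfl | hside
      · simp
      refine ((hC i Q hQ y hyQ ?_).2).trans (le_max_left _ _)
      refine (h.norm_le (fun a => hA a Q y hyQ _ (h.norm_pos a Q) (h.modular_le a Q)) i).trans ?_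
      have hside' : Q.side ≤ 4 * Q.scale y := by
        have := Q.exp_one_add_norm_le_scale y
        linarith [Real.exp_pos 1]
      have hs := Q.side_pos
      rw [Real.rpow_natCast]
      calc _ ≤ K * ((4 * Q.scale y) ^ n) ^ 2 * (A * Q.scale y ^ k) ^ 2 := by gcongr
        _ = _ := by ring
    calc N i Q ^ (-r i y) = N i Q ^ (r i Q.center - r i y) * N i Q ^ (-r i Q.center) := by
          rw [← Real.rpow_add h0]; ring_nf
      _ ≤ _ := by gcongr
  refine ⟨c⁻¹ * max C 1, by positivity, fun i hi Q hQ => ?_⟩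
  set P := √(N i Q ^ r i Q.center * N 0 Q ^ r 0 Q.center) with hP
  have hi0 := h.norm_pos i Q
  have h00 := h.norm_pos 0 Q
  have hP0 : 0 < P := by positivity
  have hint : ∫⁻ y in Q.half.toSet, ENNReal.ofReal
      √(N i Q ^ (-r i y) * ω i y * (N 0 Q ^ (-r 0 y) * ω 0 y)) ≤
      ENNReal.ofReal (max C 1 * P⁻¹) * ∫⁻ y in Q.toSet, ENNReal.ofReal √(ω i y * ω 0 y) := by
    calc _ ≤ ∫⁻ y in Q.half.toSet, ENNReal.ofReal (max C 1 * P⁻¹) *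
          ENNReal.ofReal √(ω i y * ω 0 y) := by
          refine setLIntegral_mono' Q.half.measurableSet_toSet fun y hy => ?_
          rw [← ENNReal.ofReal_mul (by positivity)]
          refine ENNReal.ofReal_le_ofReal ?_
          have e1 := hhalf i Q hQ y hy
          have e2 := hhalf 0 Q hQ y hy
          have hωi := h.density_pos i y
          have hω0 := h.density_pos 0 y
          rw [Real.sqrt_le_left (by positivity), mul_pow, Real.sq_sqrt (by positivity), mul_pow,
            inv_pow, hP, Real.sq_sqrt (by positivity), mul_inv, ← Real.rpow_neg hi0.le,
            ← Real.rpow_neg h00.le]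
          calc _ ≤ max C 1 * N i Q ^ (-r i Q.center) * ω i y *
                (max C 1 * N 0 Q ^ (-r 0 Q.center) * ω 0 y) := by gcongr
            _ = _ := by ring
      _ = ENNReal.ofReal (max C 1 * P⁻¹) *
          ∫⁻ y in Q.half.toSet, ENNReal.ofReal √(ω i y * ω 0 y) :=
          lintegral_const_mul _
            ((h.measurable_density i).mul (h.measurable_density 0)).sqrt.ennreal_ofReal
      _ ≤ _ := by gcongr; exact Q.half_subset
  have hlow : ENNReal.ofReal c ≤
      ENNReal.ofReal (max C 1 * P⁻¹) * ∫⁻ y in Q.toSet, ENNReal.ofReal √(ω i y * ω 0 y) := by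
    by_contra! hlt
    obtain ⟨X, hX0, hX1, hX2⟩ := ENNReal.lt_iff_exists_real_btwn.1 hlt
    have hXc := (ENNReal.ofReal_lt_ofReal_iff hc0).1 hX2
    have hXpos : 0 < X := ENNReal.ofReal_pos.1 (bot_le.trans_lt hX1)
    exact (hc i hi Q X hXpos (hint.trans hX1.le)).not_gt hXc
  calc ENNReal.ofReal P = ENNReal.ofReal (P * c⁻¹) * ENNReal.ofReal c := by
        rw [← ENNReal.ofReal_mul (by positivity), mul_assoc, inv_mul_cancel₀ hc0.ne', mul_one]
    _ ≤ ENNReal.ofReal (P * c⁻¹) * (ENNReal.ofReal (max C 1 * P⁻¹) *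
        ∫⁻ y in Q.toSet, ENNReal.ofReal √(ω i y * ω 0 y)) := by gcongr
    _ = _ := by
        rw [← mul_assoc, ← ENNReal.ofReal_mul (by positivity)]
        congr 2
        field_simp

end MuckenhouptTriple

/-! ### Averages of functions with bounded modular -/

theorem le_half_add_mul_rpow {A f d L B l s ρ a b D : ℝ} (hA : 0 < A) (hf : 0 ≤ f) (hd : 0 < d)
    (hL : 1 ≤ L) (hlL : 1 ≤ Real.log L) (hB : 1 ≤ B) (hl : 0 ≤ l) (hAL : A ≤ B * L ^ l)
    (hdL : d⁻¹ ≤ B * L ^ l) (ha : 1 < a) (hsa : a ≤ s) (hsb : s ≤ b) (hρa : a ≤ ρ) (hρb : ρ ≤ b)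
    (hD : |s - ρ| * Real.log L ≤ D) :
    f ≤ A / 2 + A * (2 ^ b * Real.exp ((Real.log B + l) * D) * ((f ^ s + d) / A ^ ρ)) ^ a⁻¹ := by
  set E := Real.exp ((Real.log B + l) * D) with hE
  have hE1 : 1 ≤ E := by
    have hD0 : 0 ≤ D := le_trans (by positivity) hD
    have := Real.log_nonneg hB
    exact Real.one_le_exp (by positivity)
  have hL0 : 0 < L := by linarith
  rcases le_or_gt f (A / 2) with hfA | hfA
  · have : 0 ≤ f ^ s := Real.rpow_nonneg hf _
    exact hfA.trans (le_add_of_nonneg_right (by positivity))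
  have hf0 : 0 < f := by linarith
  have hρ0 : 0 < A ^ ρ := by positivity
  have hfs : 0 < f ^ s := by positivity
  suffices hv : (f / A) ^ a ≤ 2 ^ b * E * ((f ^ s + d) / A ^ ρ) by
    rw [← Real.le_rpow_inv_iff_of_pos (by positivity) (by positivity) (by linarith),
      div_le_iff₀ hA, mul_comm] at hv
    linarith
  have hraise : ∀ τ, a ≤ τ → τ ≤ b → (f / A) ^ a ≤ 2 ^ b * (f ^ τ / A ^ τ) := by
    intro τ h1 h2
    rw [← Real.div_rpow hf hA.le]
    have h2b : (1 : ℝ) ≤ 2 ^ b := Real.one_le_rpow one_le_two (by linarith)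
    rcases le_total 1 (f / A) with h3 | h3
    · exact (Real.rpow_le_rpow_of_exponent_le h3 h1).trans
        (le_mul_of_one_le_left (by positivity) h2b)
    · have h4 : 1 ≤ 2 * (f / A) := by
        have : 1 / 2 ≤ f / A := by rw [le_div_iff₀ hA]; linarith
        linarith
      calc (f / A) ^ a ≤ 1 := Real.rpow_le_one (by positivity) h3 (by linarith)
        _ ≤ (2 * (f / A)) ^ τ := Real.one_le_rpow h4 (by linarith)
        _ = 2 ^ τ * (f / A) ^ τ := Real.mul_rpow (by norm_num) (by positivity)
        _ ≤ _ := by gcongr; norm_num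
  have hBL : 1 ≤ B * L ^ l := one_le_mul_of_one_le_of_one_le hB (Real.one_le_rpow hL hl)
  have hfix : f ^ ρ ≤ E * (f ^ s + d) → (f / A) ^ a ≤ 2 ^ b * E * ((f ^ s + d) / A ^ ρ) := by
    intro h1
    calc (f / A) ^ a ≤ 2 ^ b * (f ^ ρ / A ^ ρ) := hraise ρ hρa hρb
      _ ≤ 2 ^ b * (E * (f ^ s + d) / A ^ ρ) := by gcongr
      _ = _ := by ring
  rcases le_total f 1 with h1 | h1
  · apply hfix
    rcases le_total f d with h2 | h2
    · calc f ^ ρ ≤ f ^ (1 : ℝ) := Real.rpow_le_rpow_of_exponent_ge hf0 h1 (by linarith)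
        _ = f := Real.rpow_one f
        _ ≤ 1 * (f ^ s + d) := by linarith
        _ ≤ _ := by gcongr
    · have h3 : f ^ (ρ - s) ≤ E := rpow_le_exp_of_abs_log hf0 hlL hL0 hB hl
        (by rwa [abs_sub_comm]) (h1.trans hBL) ((inv_anti₀ hd h2).trans hdL)
      calc f ^ ρ = f ^ (ρ - s) * f ^ s := by rw [← Real.rpow_add hf0]; ring_nf
        _ ≤ E * (f ^ s + d) := by gcongr; linarith
  rcases le_total ρ s with h2 | h2
  · apply hfix
    calc f ^ ρ ≤ f ^ s := Real.rpow_le_rpow_of_exponent_le h1 h2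
      _ ≤ 1 * (f ^ s + d) := by linarith
      _ ≤ _ := by gcongr
  · have h3 : A ^ (ρ - s) ≤ E := rpow_le_exp_of_log hA hlL hL0 hB hl (by linarith)
      (by rwa [abs_sub_comm, abs_of_nonneg (by linarith)] at hD) hAL
    calc (f / A) ^ a ≤ 2 ^ b * (f ^ s / A ^ s) := hraise s hsa hsb
      _ = 2 ^ b * (A ^ (ρ - s) * (f ^ s / A ^ ρ)) := by
        rw [Real.rpow_sub hA]
        field_simp
      _ ≤ 2 ^ b * (E * ((f ^ s + d) / A ^ ρ)) := by gcongr; linarith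
      _ = _ := by ring

namespace MuckenhouptTriple

variable {n : ℕ} {r ω : Fin 3 → Rn n → ℝ} {N : Fin 3 → Cube n → ℝ} {m M K : ℝ}

theorem lintegral_mul_density_le (h : MuckenhouptTriple r ω N m M K) {i : Fin 3} {q f : Rn n → ℝ}
    (hq : ∀ x, 1 ≤ q x) (hf : ∀ x, 0 ≤ f x)
    (hmod : ∫⁻ x, ENNReal.ofReal (f x ^ q x * ω i x) ≤ 1) (Q : Cube n) :
    ∫⁻ y in Q.toSet, ENNReal.ofReal (f y * ω i y) ≤
      (∫⁻ y in Q.toSet, ENNReal.ofReal (ω i y)) + 1 := by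
  have hm := (h.measurable_density i).ennreal_ofReal
  calc _ ≤ ∫⁻ y in Q.toSet, (ENNReal.ofReal (ω i y) + ENNReal.ofReal (f y ^ q y * ω i y)) := by
        refine lintegral_mono fun y => ?_
        have h0 := h.density_pos i y
        have h1 := Real.rpow_nonneg (hf y) (q y)
        rw [← ENNReal.ofReal_add h0.le (by positivity)]
        refine ENNReal.ofReal_le_ofReal ?_
        rcases le_total (f y) 1 with h2 | h2
        · nlinarith [mul_nonneg h1 h0.le]
        · have : f y ≤ f y ^ q y := by
            simpa using Real.rpow_le_rpow_of_exponent_le h2 (hq y)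
          nlinarith
    _ = (∫⁻ y in Q.toSet, ENNReal.ofReal (ω i y)) +
          ∫⁻ y in Q.toSet, ENNReal.ofReal (f y ^ q y * ω i y) := lintegral_add_left hm _
    _ ≤ _ := by gcongr; exact (setLIntegral_le_lintegral _ _).trans hmod

/-- A Jensen-type inequality for variable exponents. -/
theorem exists_average_rpow_le (h : MuckenhouptTriple r ω N m M K) (i : Fin 3) {q : Rn n → ℝ}
    (hq : LogRegular q) {a b : ℝ} (ha : 1 < a) (hqa : ∀ x, a ≤ q x) (hqb : ∀ x, q x ≤ b) (k : ℕ) :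
    ∃ C, 0 < C ∧ ∀ f : Rn n → ℝ, Measurable f → (∀ x, 0 ≤ f x) →
      ∫⁻ x, ENNReal.ofReal (f x ^ q x * ω i x) ≤ 1 → ∀ Q : Cube n, Q.IsDyadic → ∀ Y, 0 < Y →
      ∫⁻ y in Q.toSet, ENNReal.ofReal ((f y ^ q y + decay k y) ^ a⁻¹ * ω i y) ≤
        ENNReal.ofReal Y * ∫⁻ y in Q.toSet, ENNReal.ofReal (ω i y) →
      ((∫⁻ y in Q.toSet, ENNReal.ofReal (f y * ω i y)).toReal /
        (∫⁻ y in Q.toSet, ENNReal.ofReal (ω i y)).toReal) ^ q Q.center ≤ C * Y ^ a := by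
  obtain ⟨D, hD⟩ := hq
  obtain ⟨B, l, hB1, hl, hB⟩ := h.exists_inv_lintegral_density_le
  set E := (2 : ℝ) ^ b * Real.exp ((Real.log (2 * B) + (l + k)) * D) with hE
  have hE0 : 0 < E := by positivity
  refine ⟨2 ^ a * E, by positivity, fun f hfm hf hmod Q hQ Y hY hint => ?_⟩
  have hSt := h.lintegral_density_ne_top i Q
  have hS0 := ENNReal.toReal_pos (h.lintegral_density_pos i Q).ne' hSt
  have hle := h.lintegral_mul_density_le (fun x => ha.le.trans (hqa x)) hf hmod Q
  have hIt : ∫⁻ y in Q.toSet, ENNReal.ofReal (f y * ω i y) ≠ ∞ :=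
    ne_top_of_le_ne_top (by simp [hSt]) hle
  have hSr := ENNReal.ofReal_toReal hSt
  have hIr := ENNReal.ofReal_toReal hIt
  have hBx := hB i Q
  set S := (∫⁻ y in Q.toSet, ENNReal.ofReal (ω i y)).toReal
  set I := (∫⁻ y in Q.toSet, ENNReal.ofReal (f y * ω i y)).toReal
  set A := I / S with hA
  have hqc : 0 < q Q.center := by linarith [hqa Q.center]
  have hI0 : 0 ≤ I := ENNReal.toReal_nonneg
  rcases hI0.eq_or_lt with hI | hI
  · rw [hA, ← hI, zero_div, Real.zero_rpow hqc.ne']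
    positivity
  have hA0 : 0 < A := by positivity
  have hIS : I ≤ S + 1 := by
    rw [← hIr, ← hSr, ← ENNReal.ofReal_one, ← ENNReal.ofReal_add hS0.le zero_le_one] at hle
    exact (ENNReal.ofReal_le_ofReal_iff (by positivity)).1 hle
  set G := (E / A ^ q Q.center) ^ a⁻¹ with hG
  have hG0 : 0 < G := by positivity
  have hpt : ∀ y ∈ Q.toSet, f y ≤ A / 2 + A * (G * (f y ^ q y + decay k y) ^ a⁻¹) := by
    intro y hy
    have hL := Q.one_le_scale y
    have hd := decay_pos k y
    have hfq := Real.rpow_nonneg (hf y) (q y)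
    have hkl : Q.scale y ^ (l + k) = Q.scale y ^ l * Q.scale y ^ k := by
      rw [Real.rpow_add (by linarith), Real.rpow_natCast]
    have hl1 : 1 ≤ Q.scale y ^ l := Real.one_le_rpow hL hl
    have hk1 : 1 ≤ Q.scale y ^ k := one_le_pow₀ hL
    have e1 : A ≤ 2 * B * Q.scale y ^ (l + k) := by
      have h1 : A ≤ 1 + S⁻¹ := by
        rw [hA, div_le_iff₀ hS0, add_mul, inv_mul_cancel₀ hS0.ne']; linarith
      have h2 := hBx y hy
      have h3 : 1 ≤ B * Q.scale y ^ l := one_le_mul_of_one_le_of_one_le hB1 hl1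
      rw [hkl]
      have h4 : B * Q.scale y ^ l ≤ B * Q.scale y ^ l * Q.scale y ^ k :=
        le_mul_of_one_le_right (by positivity) hk1
      linarith
    have e2 : (decay k y)⁻¹ ≤ 2 * B * Q.scale y ^ (l + k) := by
      refine (inv_decay_le_scale k Q y).trans ?_
      rw [hkl, ← mul_assoc]
      refine le_mul_of_one_le_left (by positivity) ?_
      exact one_le_mul_of_one_le_of_one_le (by linarith) hl1
    refine (le_half_add_mul_rpow hA0 (hf y) hd hL (Q.one_le_log_scale y) (by linarith)
      (by positivity) e1 e2 ha (hqa y) (hqb y) (hqa Q.center) (hqb _) (hD Q hQ y hy)).trans_eq ?_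
    rw [hG, ← Real.mul_rpow (by positivity) (by positivity)]
    congr 3
    rw [hE]
    ring
  have hmω := (h.measurable_density i).ennreal_ofReal
  have hI2 : I ≤ A / 2 * S + A * G * (Y * S) := by
    rw [← ENNReal.ofReal_le_ofReal_iff (by positivity), hIr]
    calc _ ≤ ∫⁻ y in Q.toSet, (ENNReal.ofReal (A / 2) * ENNReal.ofReal (ω i y) +
          ENNReal.ofReal (A * G) *
            ENNReal.ofReal ((f y ^ q y + decay k y) ^ a⁻¹ * ω i y)) := by
          refine setLIntegral_mono' Q.measurableSet_toSet fun y hy => ?_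
          have hω := h.density_pos i y
          have hd := decay_pos k y
          have hfq := Real.rpow_nonneg (hf y) (q y)
          rw [← ENNReal.ofReal_mul (by positivity), ← ENNReal.ofReal_mul (by positivity),
            ← ENNReal.ofReal_add (by positivity) (by positivity)]
          refine ENNReal.ofReal_le_ofReal ?_
          have := mul_le_mul_of_nonneg_right (hpt y hy) hω.le
          linarith
      _ = ENNReal.ofReal (A / 2) * (∫⁻ y in Q.toSet, ENNReal.ofReal (ω i y)) +
          ENNReal.ofReal (A * G) *
            ∫⁻ y in Q.toSet, ENNReal.ofReal ((f y ^ q y + decay k y) ^ a⁻¹ * ω i y) := by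
          rw [lintegral_add_left (hmω.const_mul _), lintegral_const_mul _ hmω,
            lintegral_const_mul' _ _ ENNReal.ofReal_ne_top]
      _ ≤ ENNReal.ofReal (A / 2) * ENNReal.ofReal S +
          ENNReal.ofReal (A * G) * (ENNReal.ofReal Y * ENNReal.ofReal S) := by
          rw [hSr]; gcongr
      _ = _ := by
          rw [← ENNReal.ofReal_mul (by positivity), ← ENNReal.ofReal_mul (by positivity),
            ← ENNReal.ofReal_mul (by positivity), ← ENNReal.ofReal_add (by positivity)
              (by positivity)]
  have hAS : A * S = I := div_mul_cancel₀ _ hS0.ne'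
  have hGY : 1 ≤ 2 * (G * Y) := by
    have : I * 1 ≤ I * (2 * (G * Y)) := by rw [← hAS] at hI2 ⊢; linarith
    exact le_of_mul_le_mul_left this hI
  have hfin := Real.one_le_rpow hGY (by linarith : 0 ≤ a)
  rw [Real.mul_rpow (by norm_num) (by positivity), Real.mul_rpow hG0.le hY.le, hG,
    ← Real.rpow_mul (by positivity), inv_mul_cancel₀ (by linarith), Real.rpow_one] at hfin
  have hAq : 0 < A ^ q Q.center := by positivity
  calc A ^ q Q.center ≤ A ^ q Q.center * (2 ^ a * (E / A ^ q Q.center * Y ^ a)) :=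
        le_mul_of_one_le_right hAq.le hfin
    _ = _ := by field_simp

end MuckenhouptTriple

/-! ### Pointwise domination of bilinear averages -/

namespace MuckenhouptTriple

variable {n : ℕ} {r ω : Fin 3 → Rn n → ℝ} {N : Fin 3 → Cube n → ℝ} {m M K : ℝ}

theorem lintegral_mul_density_le_norm (h : MuckenhouptTriple r ω N m M K) {i : Fin 3}
    {q f : Rn n → ℝ} (hq1 : ∀ x, 1 < q x) (hq : ∀ x, (q x)⁻¹ + (r i x)⁻¹ = 1)
    (hf : ∀ x, 0 ≤ f x) (hmod : ∫⁻ x, ENNReal.ofReal (f x ^ q x * ω i x) ≤ 1) (Q : Cube n) :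
    ∫⁻ y in Q.toSet, ENNReal.ofReal (f y * ω i y) ≤ ENNReal.ofReal (2 * N i Q) := by
  have h0 := h.norm_pos i Q
  have hm := h.measurable_normalized i (N i Q)
  calc _ ≤ ∫⁻ y in Q.toSet, ENNReal.ofReal (N i Q) * (ENNReal.ofReal (N i Q ^ (-r i y) * ω i y) +
        ENNReal.ofReal (f y ^ q y * ω i y)) := by
        refine lintegral_mono fun y => ?_
        have hω := h.density_pos i y
        have hfq := Real.rpow_nonneg (hf y) (q y)
        have hN : 0 < N i Q ^ (-r i y) := Real.rpow_pos_of_pos h0 _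
        rw [← ENNReal.ofReal_add (by positivity) (by positivity), ← ENNReal.ofReal_mul h0.le]
        refine ENNReal.ofReal_le_ofReal ?_
        have hc : (q y).HolderConjugate (r i y) :=
          Real.holderConjugate_iff.2 ⟨hq1 y, hq y⟩
        have hy := Real.young_inequality_of_nonneg (hf y) (inv_nonneg.2 h0.le) hc
        rw [Real.inv_rpow h0.le, ← Real.rpow_neg h0.le] at hy
        have e1 : f y ^ q y / q y ≤ f y ^ q y := div_le_self hfq (hq1 y).le
        have e2 : N i Q ^ (-r i y) / r i y ≤ N i Q ^ (-r i y) := div_le_self hN.le hc.symm.lt.le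
        have e3 : f y ≤ N i Q * (N i Q ^ (-r i y) + f y ^ q y) := by
          rw [← div_eq_mul_inv, div_le_iff₀ h0] at hy
          nlinarith
        calc f y * ω i y ≤ N i Q * (N i Q ^ (-r i y) + f y ^ q y) * ω i y := by gcongr
          _ = _ := by ring
    _ = ENNReal.ofReal (N i Q) * ((∫⁻ y in Q.toSet, ENNReal.ofReal (N i Q ^ (-r i y) * ω i y)) +
        ∫⁻ y in Q.toSet, ENNReal.ofReal (f y ^ q y * ω i y)) := by
        rw [lintegral_const_mul' _ _ ENNReal.ofReal_ne_top, lintegral_add_left hm]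
    _ ≤ ENNReal.ofReal (N i Q) * (1 + 1) := by
        gcongr
        · exact h.modular_le i Q
        · exact (setLIntegral_le_lintegral _ _).trans hmod
    _ = _ := by
        rw [mul_comm 2, ENNReal.ofReal_mul h0.le]
        norm_num

/-- Freezing the exponent at the center of a dyadic cube. -/
theorem exists_rpow_le_rpow_center (h : MuckenhouptTriple r ω N m M K) (k : ℕ) {B : ℝ}
    (hB : 1 ≤ B) : ∃ C, 0 < C ∧ ∀ Q : Cube n, Q.IsDyadic → ∀ x ∈ Q.toSet, ∀ t, 0 ≤ t →
      t * N 0 Q ≤ B → t ^ r 0 x ≤ C * (t ^ r 0 Q.center + decay k x) := by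
  obtain ⟨D, hD⟩ := h.exists_abs_sub_mul_log_le
  obtain ⟨A, l, hA1, hA⟩ := h.exists_inv_le_scale
  have hm := h.lower_pos
  set E := Real.exp ((Real.log (A * B) + (l + k / m)) * D)
  refine ⟨max E 1, by positivity, fun Q hQ x hx t ht htN => ?_⟩
  have hd := decay_pos k x
  have hd1 := decay_le_one k x
  have htc : 0 ≤ t ^ r 0 Q.center := Real.rpow_nonneg ht _
  have hr := h.exponent_pos 0 x
  rcases le_or_gt t (decay k x ^ m⁻¹) with h1 | h1
  · calc t ^ r 0 x ≤ (decay k x ^ m⁻¹) ^ r 0 x := Real.rpow_le_rpow ht h1 hr.le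
      _ = decay k x ^ (m⁻¹ * r 0 x) := (Real.rpow_mul hd.le _ _).symm
      _ ≤ decay k x ^ (1 : ℝ) := by
        refine Real.rpow_le_rpow_of_exponent_ge hd hd1 ?_
        rw [← div_eq_inv_mul, le_div_iff₀ hm, one_mul]
        exact h.lower_le 0 x
      _ = decay k x := Real.rpow_one _
      _ ≤ 1 * (t ^ r 0 Q.center + decay k x) := by linarith
      _ ≤ _ := by gcongr; exact le_max_right _ _
  · have ht0 : 0 < t := lt_of_le_of_lt (by positivity) h1
    have hL := Q.one_le_scale x
    have hN := h.norm_pos 0 Q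
    have hk : Q.scale x ^ (l + k / m) = Q.scale x ^ l * Q.scale x ^ (k / m) := by
      rw [Real.rpow_add (by linarith), Real.rpow_natCast]
    have hl1 : 1 ≤ Q.scale x ^ l := one_le_pow₀ hL
    have hk1 : 1 ≤ Q.scale x ^ (k / m) := Real.one_le_rpow hL (by positivity)
    have e1 : t ≤ A * B * Q.scale x ^ (l + k / m) := by
      have h2 := hA 0 Q x hx _ hN (h.modular_le 0 Q)
      calc t ≤ B * (N 0 Q)⁻¹ := by rwa [← div_eq_mul_inv, le_div_iff₀ hN]
        _ ≤ B * (A * Q.scale x ^ l) := by gcongr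
        _ ≤ B * (A * Q.scale x ^ l) * Q.scale x ^ (k / m) :=
          le_mul_of_one_le_right (by positivity) hk1
        _ = _ := by rw [hk]; ring
    have e2 : t⁻¹ ≤ A * B * Q.scale x ^ (l + k / m) := by
      calc t⁻¹ ≤ (decay k x ^ m⁻¹)⁻¹ := inv_anti₀ (by positivity) h1.le
        _ = ((decay k x)⁻¹) ^ m⁻¹ := (Real.inv_rpow hd.le _).symm
        _ ≤ (Q.scale x ^ (k : ℝ)) ^ m⁻¹ := by
          rw [Real.rpow_natCast]
          gcongr
          exact inv_decay_le_scale k Q x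
        _ = Q.scale x ^ (k / m) := by rw [← Real.rpow_mul (by linarith), ← div_eq_mul_inv]
        _ ≤ A * B * Q.scale x ^ l * Q.scale x ^ (k / m) := by
          refine le_mul_of_one_le_left (by positivity) ?_
          exact one_le_mul_of_one_le_of_one_le (one_le_mul_of_one_le_of_one_le hA1 hB) hl1
        _ = _ := by rw [hk]; ring
    have h3 : t ^ (r 0 x - r 0 Q.center) ≤ E := rpow_le_exp_of_abs_log ht0
      (Q.one_le_log_scale x) (by linarith) (one_le_mul_of_one_le_of_one_le hA1 hB)
      (by positivity) (hD 0 Q hQ x hx) e1 e2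
    calc t ^ r 0 x = t ^ (r 0 x - r 0 Q.center) * t ^ r 0 Q.center := by
          rw [← Real.rpow_add ht0]; ring_nf
      _ ≤ max E 1 * (t ^ r 0 Q.center + decay k x) := by
          gcongr
          · exact h3.trans (le_max_left _ _)
          · linarith

end MuckenhouptTriple

section Majorant

variable {n : ℕ}

/-- The measure with density `ω`. -/
def weightMeasure (ω : Rn n → ℝ) : Measure (Rn n) :=
  volume.withDensity fun x => ENNReal.ofReal (ω x)

theorem lintegral_weightMeasure {ω : Rn n → ℝ} (hω : Measurable ω) {g : Rn n → ℝ≥0∞}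
    (hg : Measurable g) :
    ∫⁻ x, g x ∂weightMeasure ω = ∫⁻ x, ENNReal.ofReal (ω x) * g x :=
  lintegral_withDensity_eq_lintegral_mul _ hω.ennreal_ofReal hg

theorem setLIntegral_weightMeasure {ω : Rn n → ℝ} (hω : Measurable ω) {g : Rn n → ℝ≥0∞}
    (hg : Measurable g) (Q : Cube n) :
    ∫⁻ x in Q.toSet, g x ∂weightMeasure ω = ∫⁻ x in Q.toSet, ENNReal.ofReal (ω x) * g x :=
  setLIntegral_withDensity_eq_setLIntegral_mul _ hω.ennreal_ofReal hg Q.measurableSet_toSet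

theorem weightMeasure_toSet (ω : Rn n → ℝ) (Q : Cube n) :
    weightMeasure ω Q.toSet = ∫⁻ x in Q.toSet, ENNReal.ofReal (ω x) :=
  withDensity_apply _ Q.measurableSet_toSet

/-- The function `(f ^ q + decay) ^ (1 / a)`. -/
def regularized (q f : Rn n → ℝ) (a : ℝ) (k : ℕ) (x : Rn n) : ℝ≥0∞ :=
  ENNReal.ofReal ((f x ^ q x + decay k x) ^ a⁻¹)

theorem measurable_regularized {q f : Rn n → ℝ} (hq : Measurable q) (hf : Measurable f) (a : ℝ)
    (k : ℕ) : Measurable (regularized q f a k) :=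
  (((hf.pow hq).add (measurable_decay k)).pow_const _).ennreal_ofReal

/-- The function whose dyadic maximal function dominates bilinear averages. -/
def majorant (u σ q f : Rn n → ℝ) (a : ℝ) (k : ℕ) (x : Rn n) : ℝ≥0∞ :=
  (dyMax (weightMeasure σ) (regularized q f a k) x ^ a * ENNReal.ofReal (σ x / u x)) ^ (1 / 2 : ℝ)

theorem measurable_majorant {u σ : Rn n → ℝ} (hu : Measurable u) (hσ : Measurable σ)
    (q f : Rn n → ℝ) (a : ℝ) (k : ℕ) : Measurable (majorant u σ q f a k) :=
  (((measurable_dyMax _ _).pow_const _).mul (hσ.div hu).ennreal_ofReal).pow_const _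

end Majorant

namespace MuckenhouptTriple

variable {n : ℕ} {r ω : Fin 3 → Rn n → ℝ} {N : Fin 3 → Cube n → ℝ} {m M K : ℝ}

/-- Lower bound for the dyadic maximal function of the majorant. -/
theorem exists_rpow_mul_le_dyMax_majorant (h : MuckenhouptTriple r ω N m M K) {i : Fin 3}
    (hi : i ≠ 0) {a : ℝ} (ha : 0 < a) (k : ℕ) : ∃ C, 0 < C ∧ ∀ q f : Rn n → ℝ,
      ∀ Q : Cube n, Q.IsDyadic → ∀ Y, 0 < Y →
      (∀ z ∈ Q.toSet, ENNReal.ofReal Y ≤ dyMax (weightMeasure (ω i)) (regularized q f a k) z) →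
      ∀ x ∈ Q.toSet, ENNReal.ofReal (Y ^ a * N i Q ^ r i Q.center / N 0 Q ^ r 0 Q.center) ≤
        ENNReal.ofReal C *
          dyMax (weightMeasure (ω 0)) (majorant (ω 0) (ω i) q f a k) x ^ 2 := by
  obtain ⟨C₁, hC₁, h1⟩ := h.exists_lintegral_density_le_norm_rpow
  obtain ⟨C₂, hC₂, h2⟩ := h.exists_sqrt_norm_le_lintegral
  refine ⟨(C₂ * C₁) ^ 2, by positivity, fun q f Q hQ Y hY hz x hx => ?_⟩
  set D := dyMax (weightMeasure (ω 0)) (majorant (ω 0) (ω i) q f a k) x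
  have hNi : 0 < N i Q ^ r i Q.center := Real.rpow_pos_of_pos (h.norm_pos i Q) _
  have hN0 : 0 < N 0 Q ^ r 0 Q.center := Real.rpow_pos_of_pos (h.norm_pos 0 Q) _
  have hYa : 0 < Y ^ a := Real.rpow_pos_of_pos hY _
  have hmaj := measurable_majorant (h.measurable_density 0) (h.measurable_density i) q f a k
  have e1 : ENNReal.ofReal √(Y ^ a) * ∫⁻ y in Q.toSet, ENNReal.ofReal √(ω i y * ω 0 y) ≤
      ∫⁻ y in Q.toSet, majorant (ω 0) (ω i) q f a k y ∂weightMeasure (ω 0) := by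
    rw [setLIntegral_weightMeasure (h.measurable_density 0) hmaj,
      ← lintegral_const_mul' _ _ ENNReal.ofReal_ne_top]
    refine setLIntegral_mono' Q.measurableSet_toSet fun z hzQ => ?_
    have hi0 := h.density_pos i z
    have h00 := h.density_pos 0 z
    calc _ = ENNReal.ofReal (ω 0 z) *
          (ENNReal.ofReal Y ^ a * ENNReal.ofReal (ω i z / ω 0 z)) ^ (1 / 2 : ℝ) := by
          rw [ENNReal.ofReal_rpow_of_pos hY, ← ENNReal.ofReal_mul hYa.le,
            ENNReal.ofReal_rpow_of_nonneg (by positivity) (by norm_num),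
            ← ENNReal.ofReal_mul (Real.sqrt_nonneg _), ← ENNReal.ofReal_mul h00.le,
            ← Real.sqrt_eq_rpow, ← Real.sqrt_mul hYa.le]
          congr 1
          rw [Real.sqrt_eq_iff_mul_self_eq (by positivity) (by positivity), mul_mul_mul_comm,
            Real.mul_self_sqrt (by positivity)]
          field_simp
      _ ≤ _ := by
          unfold majorant
          gcongr
          exact hz z hzQ
  have hU0 : weightMeasure (ω 0) Q.toSet ≠ 0 := by
    rw [weightMeasure_toSet]; exact (h.lintegral_density_pos 0 Q).ne'
  have hUt : weightMeasure (ω 0) Q.toSet ≠ ∞ := by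
    rw [weightMeasure_toSet]; exact h.lintegral_density_ne_top 0 Q
  have e2 : ∫⁻ y in Q.toSet, majorant (ω 0) (ω i) q f a k y ∂weightMeasure (ω 0) ≤
      ENNReal.ofReal (C₁ * N 0 Q ^ r 0 Q.center) * D := by
    have := average_le_dyMax (weightMeasure (ω 0)) (majorant (ω 0) (ω i) q f a k) hQ hx
    rw [ENNReal.inv_mul_le_iff hU0 hUt] at this
    refine this.trans ?_
    gcongr
    rw [weightMeasure_toSet]
    exact h1 0 Q hQ
  have e3 : ENNReal.ofReal √(Y ^ a * (N i Q ^ r i Q.center * N 0 Q ^ r 0 Q.center)) ≤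
      ENNReal.ofReal (C₂ * C₁ * N 0 Q ^ r 0 Q.center) * D := by
    rw [Real.sqrt_mul hYa.le, ENNReal.ofReal_mul (Real.sqrt_nonneg _), mul_assoc C₂,
      ENNReal.ofReal_mul hC₂.le, mul_assoc (ENNReal.ofReal C₂)]
    calc _ ≤ ENNReal.ofReal √(Y ^ a) * (ENNReal.ofReal C₂ *
          ∫⁻ y in Q.toSet, ENNReal.ofReal √(ω i y * ω 0 y)) := by gcongr; exact h2 i hi Q hQ
      _ = ENNReal.ofReal C₂ * (ENNReal.ofReal √(Y ^ a) *
          ∫⁻ y in Q.toSet, ENNReal.ofReal √(ω i y * ω 0 y)) := by ring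
      _ ≤ _ := mul_le_mul_right (e1.trans e2) _
  have e4 := pow_le_pow_left₀ (zero_le (a := ENNReal.ofReal _)) e3 2
  rw [mul_pow, ← ENNReal.ofReal_pow (Real.sqrt_nonneg _), Real.sq_sqrt (by positivity),
    ← ENNReal.ofReal_pow (by positivity)] at e4
  calc _ = ENNReal.ofReal (((N 0 Q ^ r 0 Q.center) ^ 2)⁻¹) *
        ENNReal.ofReal (Y ^ a * (N i Q ^ r i Q.center * N 0 Q ^ r 0 Q.center)) := by
        rw [← ENNReal.ofReal_mul (by positivity)]
        congr 1
        field_simp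
    _ ≤ ENNReal.ofReal (((N 0 Q ^ r 0 Q.center) ^ 2)⁻¹) *
        (ENNReal.ofReal ((C₂ * C₁ * N 0 Q ^ r 0 Q.center) ^ 2) * D ^ 2) := by gcongr
    _ = _ := by
        rw [← mul_assoc, ← ENNReal.ofReal_mul (by positivity)]
        congr 2
        field_simp

/-- Each factor of a bilinear average is dominated by an iterated maximal function. -/
theorem exists_average_le_dyMax_majorant (h : MuckenhouptTriple r ω N m M K) {i : Fin 3}
    (hi : i ≠ 0) {q : Rn n → ℝ} (hqm : Measurable q) (hql : LogRegular q) {a b : ℝ} (ha : 1 < a)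
    (hqa : ∀ x, a ≤ q x) (hqb : ∀ x, q x ≤ b) (hq : ∀ x, (q x)⁻¹ + (r i x)⁻¹ = 1) (k : ℕ) :
    ∃ C, 0 < C ∧ ∀ f : Rn n → ℝ, Measurable f → (∀ x, 0 ≤ f x) →
      ∫⁻ x, ENNReal.ofReal (f x ^ q x * ω i x) ≤ 1 → ∀ Q : Cube n, Q.IsDyadic → ∀ x ∈ Q.toSet,
      ENNReal.ofReal ((N 0 Q ^ r 0 Q.center)⁻¹ *
        ((∫⁻ y in Q.toSet, ENNReal.ofReal (f y * ω i y)).toReal / N i Q) ^ q Q.center) ≤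
      ENNReal.ofReal C *
        dyMax (weightMeasure (ω 0)) (majorant (ω 0) (ω i) q f a k) x ^ 2 := by
  obtain ⟨C₁, hC₁, h1⟩ := h.exists_lintegral_density_le_norm_rpow
  obtain ⟨C₂, hC₂, h2⟩ := h.exists_rpow_mul_le_dyMax_majorant hi (zero_lt_one.trans ha) k
  obtain ⟨C₃, hC₃, h3⟩ := h.exists_average_rpow_le i hql ha hqa hqb k
  have hC : (1 : ℝ) ≤ max C₁ 1 := le_max_right _ _
  refine ⟨C₃ * max C₁ 1 ^ b * C₂, by positivity, fun f hfm hf hmod Q hQ x hx => ?_⟩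
  have hS0 := h.lintegral_density_pos i Q
  have hSt := h.lintegral_density_ne_top i Q
  set S := ∫⁻ y in Q.toSet, ENNReal.ofReal (ω i y)
  set I := (∫⁻ y in Q.toSet, ENNReal.ofReal (f y * ω i y)).toReal
  have hI : 0 ≤ I := ENNReal.toReal_nonneg
  have hs : 0 < S.toReal := ENNReal.toReal_pos hS0.ne' hSt
  have hNi := h.norm_pos i Q
  have hN0 : 0 < N 0 Q ^ r 0 Q.center := Real.rpow_pos_of_pos (h.norm_pos 0 Q) _
  have hρ := h.exponent_pos i Q.center
  have hqc : 0 < q Q.center := by linarith [hqa Q.center]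
  set A := ∫⁻ y in Q.toSet, ENNReal.ofReal ((f y ^ q y + decay k y) ^ a⁻¹ * ω i y) with hA
  have hreg : ∀ y, 0 < (f y ^ q y + decay k y) ^ a⁻¹ := fun y => by
    have := Real.rpow_nonneg (hf y) (q y)
    have := decay_pos k y
    positivity
  have hAm : Measurable fun y => ENNReal.ofReal ((f y ^ q y + decay k y) ^ a⁻¹ * ω i y) :=
    ((((hfm.pow hqm).add (measurable_decay k)).pow_const _).mul
      (h.measurable_density i)).ennreal_ofReal
  have hA0 : A ≠ 0 := by
    intro h0
    rw [hA, setLIntegral_eq_zero_iff Q.measurableSet_toSet hAm] at h0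
    have : S = 0 := by
      rw [setLIntegral_eq_zero_iff Q.measurableSet_toSet
        (h.measurable_density i).ennreal_ofReal]
      filter_upwards [h0] with y hy hyQ
      have := hy hyQ
      rw [ENNReal.ofReal_eq_zero] at this
      exact absurd this (not_le.2 (mul_pos (hreg y) (h.density_pos i y)))
    exact hS0.ne' this
  have hAt : A ≠ ∞ := by
    have : A ≤ 2 * S + 1 := by
      calc A ≤ ∫⁻ y in Q.toSet, (2 * ENNReal.ofReal (ω i y) +
            ENNReal.ofReal (f y ^ q y * ω i y)) := by
            refine lintegral_mono fun y => ?_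
            have hω := h.density_pos i y
            have hfq := Real.rpow_nonneg (hf y) (q y)
            have hd := decay_pos k y
            have e : (f y ^ q y + decay k y) ^ a⁻¹ ≤ 2 + f y ^ q y := by
              calc _ ≤ (1 + (f y ^ q y + decay k y)) ^ a⁻¹ :=
                    Real.rpow_le_rpow (by positivity) (by linarith) (by positivity)
                _ ≤ (1 + (f y ^ q y + decay k y)) ^ (1 : ℝ) := by
                  apply Real.rpow_le_rpow_of_exponent_le
                  · linarith
                  · exact inv_le_one_of_one_le₀ ha.le
                _ ≤ _ := by rw [Real.rpow_one]; linarith [decay_le_one k y]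
            rw [show (2 : ℝ≥0∞) = ENNReal.ofReal 2 by norm_num, ← ENNReal.ofReal_mul (by norm_num),
              ← ENNReal.ofReal_add (by positivity) (by positivity), ← add_mul]
            exact ENNReal.ofReal_le_ofReal (by gcongr)
        _ = 2 * S + ∫⁻ y in Q.toSet, ENNReal.ofReal (f y ^ q y * ω i y) := by
            rw [lintegral_add_left ((h.measurable_density i).ennreal_ofReal.const_mul _),
              lintegral_const_mul' _ _ (by norm_num)]
        _ ≤ _ := by gcongr; exact (setLIntegral_le_lintegral _ _).trans hmod
    exact ne_top_of_le_ne_top (by finiteness) this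
  set Y := (S⁻¹ * A).toReal
  have hYt : S⁻¹ * A ≠ ∞ := ENNReal.mul_ne_top (ENNReal.inv_ne_top.2 hS0.ne') hAt
  have hY : 0 < Y := ENNReal.toReal_pos (mul_ne_zero (ENNReal.inv_ne_zero.2 hSt) hA0) hYt
  have hYe : ENNReal.ofReal Y = S⁻¹ * A := ENNReal.ofReal_toReal hYt
  have hYa : 0 < Y ^ a := Real.rpow_pos_of_pos hY _
  have e1 : (I / S.toReal) ^ q Q.center ≤ C₃ * Y ^ a := by
    refine h3 f hfm hf hmod Q hQ Y hY ?_
    rw [hYe, mul_right_comm, ENNReal.inv_mul_cancel hS0.ne' hSt, one_mul]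
  have e2 : ∀ z ∈ Q.toSet, ENNReal.ofReal Y ≤
      dyMax (weightMeasure (ω i)) (regularized q f a k) z := by
    intro z hz
    refine le_trans (le_of_eq ?_) (average_le_dyMax _ _ hQ hz)
    rw [hYe, weightMeasure_toSet, setLIntegral_weightMeasure (h.measurable_density i)
      (measurable_regularized hqm hfm a k)]
    congr 1
    refine lintegral_congr fun y => ?_
    rw [regularized, mul_comm, ENNReal.ofReal_mul (h.density_pos i y).le]
  have e3 : (S.toReal / N i Q) ^ q Q.center ≤ max C₁ 1 ^ b * N i Q ^ r i Q.center := by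
    have hS : S.toReal ≤ max C₁ 1 * N i Q ^ r i Q.center := by
      refine ENNReal.toReal_le_of_le_ofReal (by positivity) ((h1 i Q hQ).trans ?_)
      exact ENNReal.ofReal_le_ofReal (by gcongr; exact le_max_left _ _)
    calc (S.toReal / N i Q) ^ q Q.center
        ≤ (max C₁ 1 * N i Q ^ (r i Q.center - 1)) ^ q Q.center := by
          refine Real.rpow_le_rpow (by positivity) ?_ hqc.le
          rw [div_le_iff₀ hNi, mul_assoc, Real.rpow_sub_one hNi.ne', div_mul_cancel₀ _ hNi.ne']
          exact hS
      _ = max C₁ 1 ^ q Q.center * N i Q ^ r i Q.center := by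
          rw [Real.mul_rpow (by positivity) (by positivity), ← Real.rpow_mul hNi.le]
          congr 2
          have := hq Q.center
          field_simp at this
          linarith
      _ ≤ _ := by gcongr; exact hqb _
  calc _ ≤ ENNReal.ofReal (C₃ * max C₁ 1 ^ b *
        (Y ^ a * N i Q ^ r i Q.center / N 0 Q ^ r 0 Q.center)) := by
        refine ENNReal.ofReal_le_ofReal ?_
        calc _ = (N 0 Q ^ r 0 Q.center)⁻¹ *
              ((I / S.toReal) ^ q Q.center * (S.toReal / N i Q) ^ q Q.center) := by
              rw [← Real.mul_rpow (by positivity) (by positivity), div_mul_div_cancel₀ hs.ne']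
          _ ≤ (N 0 Q ^ r 0 Q.center)⁻¹ *
              ((C₃ * Y ^ a) * (max C₁ 1 ^ b * N i Q ^ r i Q.center)) := by gcongr
          _ = _ := by ring
    _ ≤ _ := by
        have hc : 0 ≤ C₃ * max C₁ 1 ^ b := by positivity
        rw [ENNReal.ofReal_mul hc, ENNReal.ofReal_mul hc, mul_assoc]
        exact mul_le_mul_right (h2 q f Q hQ Y hY e2 x hx) _

end MuckenhouptTriple

theorem lintegral_dyMax_majorant_sq_le {n : ℕ} {u σ q f : Rn n → ℝ} (hum : Measurable u)
    (hσm : Measurable σ) (hqm : Measurable q) (hfm : Measurable f) (hu : ∀ x, 0 < u x)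
    (hσ : ∀ x, 0 < σ x) (hf : ∀ x, 0 ≤ f x) {a : ℝ} (ha : 1 < a) (k : ℕ) :
    ∫⁻ x, dyMax (weightMeasure u) (majorant u σ q f a k) x ^ 2 ∂weightMeasure u ≤
      ENNReal.ofReal 8 * (ENNReal.ofReal (2 ^ a * a / (a - 1)) *
        ((∫⁻ x, ENNReal.ofReal (f x ^ q x * σ x)) +
          ∫⁻ x, ENNReal.ofReal (σ x * decay k x))) := by
  have hmaj := measurable_majorant hum hσm q f a k
  have hreg := measurable_regularized hqm hfm a k
  have ha0 : 0 < a := zero_lt_one.trans ha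
  have e1 : ∫⁻ x, majorant u σ q f a k x ^ (2 : ℝ) ∂weightMeasure u =
      ∫⁻ x, dyMax (weightMeasure σ) (regularized q f a k) x ^ a ∂weightMeasure σ := by
    rw [lintegral_weightMeasure hum (hmaj.pow_const _),
      lintegral_weightMeasure hσm ((measurable_dyMax _ _).pow_const _)]
    refine lintegral_congr fun x => ?_
    rw [majorant, ← ENNReal.rpow_mul, one_div_mul_cancel two_ne_zero, ENNReal.rpow_one,
      mul_left_comm, mul_comm, ← ENNReal.ofReal_mul (hu x).le, mul_div_cancel₀ _ (hu x).ne']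
  have e2 : ∫⁻ x, regularized q f a k x ^ a ∂weightMeasure σ =
      (∫⁻ x, ENNReal.ofReal (f x ^ q x * σ x)) + ∫⁻ x, ENNReal.ofReal (σ x * decay k x) := by
    rw [lintegral_weightMeasure hσm (hreg.pow_const _), ← lintegral_add_left]
    · refine lintegral_congr fun x => ?_
      have hfq := Real.rpow_nonneg (hf x) (q x)
      have hd := decay_pos k x
      have hs := hσ x
      rw [regularized, ENNReal.ofReal_rpow_of_nonneg (by positivity) ha0.le,
        ← Real.rpow_mul (by positivity), inv_mul_cancel₀ ha0.ne', Real.rpow_one,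
        ← ENNReal.ofReal_mul hs.le, ← ENNReal.ofReal_add (by positivity) (by positivity)]
      ring_nf
    · exact ((hfm.pow hqm).mul hσm).ennreal_ofReal
  have e3 := lintegral_dyMax_rpow_le (weightMeasure u) (one_lt_two (α := ℝ)) hmaj
  have e4 := lintegral_dyMax_rpow_le (weightMeasure σ) ha hreg
  rw [show (2 : ℝ) ^ (2 : ℝ) * 2 / (2 - 1) = 8 by norm_num, e1] at e3
  simp_rw [ENNReal.rpow_two] at e3
  rw [e2] at e4
  exact e3.trans (mul_le_mul_right e4 _)

/-- Exponents conjugate to the last two exponents of a triple. -/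
structure ConjugateExponents {n : ℕ} (r q : Fin 3 → Rn n → ℝ) (a b : ℝ) : Prop where
  one_lt : 1 < a
  measurable : ∀ i, i ≠ 0 → Measurable (q i)
  logRegular : ∀ i, i ≠ 0 → LogRegular (q i)
  lower_le : ∀ i, i ≠ 0 → ∀ x, a ≤ q i x
  le_upper : ∀ i, i ≠ 0 → ∀ x, q i x ≤ b
  inv_add_inv : ∀ i, i ≠ 0 → ∀ x, (q i x)⁻¹ + (r i x)⁻¹ = 1

namespace MuckenhouptTriple

variable {n : ℕ} {r ω q : Fin 3 → Rn n → ℝ} {N : Fin 3 → Cube n → ℝ} {m M K a b : ℝ}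

theorem mul_rpow_le_add (h : MuckenhouptTriple r ω N m M K) (hq : ConjugateExponents r q a b)
    {s t : ℝ} (hs : 0 ≤ s) (ht : 0 ≤ t) (x : Rn n) :
    (s * t) ^ r 0 x ≤ s ^ q 1 x + t ^ q 2 x := by
  have hr := h.exponent_pos 0 x
  have h1 : 1 < q 1 x := hq.one_lt.trans_le (hq.lower_le 1 (by decide) x)
  have h2 : 1 < q 2 x := hq.one_lt.trans_le (hq.lower_le 2 (by decide) x)
  have hsum : (q 1 x)⁻¹ + (q 2 x)⁻¹ = (r 0 x)⁻¹ := by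
    have e := h.sum_inv x
    rw [Fin.sum_univ_three] at e
    linarith [hq.inv_add_inv 1 (by decide) x, hq.inv_add_inv 2 (by decide) x]
  have e1 : r 0 x ≤ q 1 x := by
    rw [← inv_le_inv₀ (by linarith) hr, ← hsum]
    have : 0 < (q 2 x)⁻¹ := by positivity
    linarith
  have e2 : r 0 x ≤ q 2 x := by
    rw [← inv_le_inv₀ (by linarith) hr, ← hsum]
    have : 0 < (q 1 x)⁻¹ := by positivity
    linarith
  have hc : (q 1 x / r 0 x).HolderConjugate (q 2 x / r 0 x) := by
    refine Real.holderConjugate_iff.2 ⟨?_, ?_⟩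
    · rw [one_lt_div hr, ← inv_lt_inv₀ (by linarith) hr, ← hsum]
      have : 0 < (q 2 x)⁻¹ := by positivity
      linarith
    · rw [inv_div, inv_div, div_eq_mul_inv, div_eq_mul_inv, ← mul_add, hsum,
        mul_inv_cancel₀ hr.ne']
  have hy := Real.young_inequality_of_nonneg (Real.rpow_nonneg hs (r 0 x))
    (Real.rpow_nonneg ht (r 0 x)) hc
  rw [← Real.rpow_mul hs, ← Real.rpow_mul ht, mul_div_cancel₀ _ hr.ne',
    mul_div_cancel₀ _ hr.ne'] at hy
  rw [Real.mul_rpow hs ht]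
  refine hy.trans (add_le_add ?_ ?_)
  · exact div_le_self (Real.rpow_nonneg hs _) ((one_le_div hr).2 e1)
  · exact div_le_self (Real.rpow_nonneg ht _) ((one_le_div hr).2 e2)

/-- Pointwise domination of the bilinear averages over dyadic cubes. -/
theorem exists_bilinear_average_rpow_le (h : MuckenhouptTriple r ω N m M K)
    (hq : ConjugateExponents r q a b) (k : ℕ) :
    ∃ C, 0 < C ∧ ∀ f : Fin 3 → Rn n → ℝ, (∀ i, i ≠ 0 → Measurable (f i)) →
      (∀ i, i ≠ 0 → ∀ x, 0 ≤ f i x) →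
      (∀ i, i ≠ 0 → ∫⁻ x, ENNReal.ofReal (f i x ^ q i x * ω i x) ≤ 1) →
      ∀ Q : Cube n, Q.IsDyadic → ∀ x ∈ Q.toSet,
      ENNReal.ofReal (((∫⁻ y in Q.toSet, ENNReal.ofReal (f 1 y * ω 1 y)).toReal *
        (∫⁻ y in Q.toSet, ENNReal.ofReal (f 2 y * ω 2 y)).toReal / (Q.side ^ n) ^ 2) ^ r 0 x) ≤
      ENNReal.ofReal C *
        (dyMax (weightMeasure (ω 0)) (majorant (ω 0) (ω 1) (q 1) (f 1) a k) x ^ 2 +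
        dyMax (weightMeasure (ω 0)) (majorant (ω 0) (ω 2) (q 2) (f 2) a k) x ^ 2 +
        ENNReal.ofReal (decay k x)) := by
  have i1 : (1 : Fin 3) ≠ 0 := by decide
  have i2 : (2 : Fin 3) ≠ 0 := by decide
  have hK := h.one_le_const
  have hq1 : ∀ i, i ≠ 0 → ∀ x, 1 < q i x := fun i hi x => hq.one_lt.trans_le (hq.lower_le i hi x)
  obtain ⟨C₁, hC₁, h1⟩ := h.exists_average_le_dyMax_majorant i1 (hq.measurable 1 i1)
    (hq.logRegular 1 i1) hq.one_lt (hq.lower_le 1 i1) (hq.le_upper 1 i1) (hq.inv_add_inv 1 i1) k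
  obtain ⟨C₂, hC₂, h2⟩ := h.exists_average_le_dyMax_majorant i2 (hq.measurable 2 i2)
    (hq.logRegular 2 i2) hq.one_lt (hq.lower_le 2 i2) (hq.le_upper 2 i2) (hq.inv_add_inv 2 i2) k
  obtain ⟨C₃, hC₃, h3⟩ := h.exists_rpow_le_rpow_center k (B := 4 * K) (by linarith)
  refine ⟨C₃ * (K ^ M * C₁ + K ^ M * C₂ + 1), by positivity,
    fun f hfm hf hmod Q hQ x hx => ?_⟩
  have g1 := h1 (f 1) (hfm 1 i1) (hf 1 i1) (hmod 1 i1) Q hQ x hx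
  have g2 := h2 (f 2) (hfm 2 i2) (hf 2 i2) (hmod 2 i2) Q hQ x hx
  have hN0 := h.norm_pos 0 Q
  have hb : ∀ i, i ≠ 0 → (∫⁻ y in Q.toSet, ENNReal.ofReal (f i y * ω i y)).toReal / N i Q ≤ 2 := by
    intro i hi
    rw [div_le_iff₀ (h.norm_pos i Q)]
    refine ENNReal.toReal_le_of_le_ofReal (by have := h.norm_pos i Q; positivity) ?_
    exact h.lintegral_mul_density_le_norm (hq1 i hi) (hq.inv_add_inv i hi) (hf i hi) (hmod i hi) Q
  have hb1 := hb 1 i1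
  have hb2 := hb 2 i2
  have hN1 := h.norm_pos 1 Q
  have hN2 := h.norm_pos 2 Q
  set I₁ := (∫⁻ y in Q.toSet, ENNReal.ofReal (f 1 y * ω 1 y)).toReal
  set I₂ := (∫⁻ y in Q.toSet, ENNReal.ofReal (f 2 y * ω 2 y)).toReal
  have hI₁ : 0 ≤ I₁ := ENNReal.toReal_nonneg
  have hI₂ : 0 ≤ I₂ := ENNReal.toReal_nonneg
  have hV := Q.side_pow_pos
  set t := I₁ * I₂ / (Q.side ^ n) ^ 2
  have ht0 : 0 ≤ t := by positivity
  have htN : t * N 0 Q ≤ K * ((I₁ / N 1 Q) * (I₂ / N 2 Q)) := by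
    have e := h.prod_le Q
    rw [Fin.prod_univ_three] at e
    calc t * N 0 Q = (I₁ / N 1 Q) * (I₂ / N 2 Q) * (N 0 Q * N 1 Q * N 2 Q) /
          (Q.side ^ n) ^ 2 := by simp only [t]; field_simp
      _ ≤ (I₁ / N 1 Q) * (I₂ / N 2 Q) * (K * (Q.side ^ n) ^ 2) / (Q.side ^ n) ^ 2 := by gcongr
      _ = _ := by field_simp
  have htB : t * N 0 Q ≤ 4 * K := by
    calc _ ≤ K * ((I₁ / N 1 Q) * (I₂ / N 2 Q)) := htN
      _ ≤ K * (2 * 2) := by gcongr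
      _ = _ := by ring
  have hr := h.exponent_pos 0 Q.center
  set z := (N 0 Q ^ r 0 Q.center)⁻¹ with hz
  have hz0 : 0 < z := inv_pos.2 (Real.rpow_pos_of_pos hN0 _)
  have etc : t ^ r 0 Q.center ≤ K ^ M * (z * (I₁ / N 1 Q) ^ q 1 Q.center) +
      K ^ M * (z * (I₂ / N 2 Q) ^ q 2 Q.center) := by
    calc t ^ r 0 Q.center ≤ (K * ((I₁ / N 1 Q) * (I₂ / N 2 Q)) * (N 0 Q)⁻¹) ^ r 0 Q.center := by
          refine Real.rpow_le_rpow ht0 ?_ hr.le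
          rwa [← div_eq_mul_inv, le_div_iff₀ hN0]
      _ = K ^ r 0 Q.center * ((I₁ / N 1 Q) * (I₂ / N 2 Q)) ^ r 0 Q.center * z := by
          rw [Real.mul_rpow (by positivity) (by positivity),
            Real.mul_rpow (by positivity) (by positivity), Real.inv_rpow hN0.le]
      _ ≤ K ^ M * ((I₁ / N 1 Q) ^ q 1 Q.center + (I₂ / N 2 Q) ^ q 2 Q.center) * z := by
          gcongr
          · exact h.le_upper 0 _
          · exact h.mul_rpow_le_add hq (by positivity) (by positivity) _
      _ = _ := by ring
  have e := (h3 Q hQ x hx t ht0 htB).trans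
    (mul_le_mul_of_nonneg_left (add_le_add_left etc (decay k x)) hC₃.le)
  have hKM : 0 ≤ K ^ M := by positivity
  have hd := decay_pos k x
  refine (ENNReal.ofReal_le_ofReal e).trans ?_
  rw [ENNReal.ofReal_mul hC₃.le, ENNReal.ofReal_add (by positivity) hd.le,
    ENNReal.ofReal_add (by positivity) (by positivity), ENNReal.ofReal_mul hKM,
    ENNReal.ofReal_mul hKM, ENNReal.ofReal_mul hC₃.le, mul_assoc]
  refine mul_le_mul_right ?_ _
  rw [mul_add, mul_add]
  refine add_le_add (add_le_add ?_ ?_) ?_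
  · refine (mul_le_mul_right g1 _).trans ?_
    rw [← mul_assoc, ← ENNReal.ofReal_mul hKM]
    gcongr
    have := mul_nonneg hKM hC₂.le
    linarith
  · refine (mul_le_mul_right g2 _).trans ?_
    rw [← mul_assoc, ← ENNReal.ofReal_mul hKM]
    gcongr
    have := mul_nonneg hKM hC₁.le
    linarith
  · refine le_mul_of_one_le_left (zero_le) ?_
    rw [ENNReal.one_le_ofReal]
    have := mul_nonneg hKM hC₁.le
    have := mul_nonneg hKM hC₂.le
    linarith

/-- The modular estimate for the dyadic bilinear maximal operator. -/
theorem exists_lintegral_biMaxD_rpow_le (h : MuckenhouptTriple r ω N m M K)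
    (hq : ConjugateExponents r q a b) :
    ∃ C : ℝ≥0∞, C ≠ ∞ ∧ ∀ f : Fin 3 → Rn n → ℝ, (∀ i, i ≠ 0 → Measurable (f i)) →
      (∀ i, i ≠ 0 → ∀ x, 0 ≤ f i x) →
      (∀ i, i ≠ 0 → ∫⁻ x, ENNReal.ofReal (f i x ^ q i x * ω i x) ≤ 1) →
      ∫⁻ x, biMaxD (fun y => f 1 y * ω 1 y) (fun y => f 2 y * ω 2 y) x ^ r 0 x *
        ENNReal.ofReal (ω 0 x) ≤ C := by
  have i1 : (1 : Fin 3) ≠ 0 := by decide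
  have i2 : (2 : Fin 3) ≠ 0 := by decide
  obtain ⟨k, T, hT, hdecay⟩ := h.exists_lintegral_density_mul_decay_le
  obtain ⟨C, hC, hpt⟩ := h.exists_bilinear_average_rpow_le hq k
  set B := ENNReal.ofReal 8 * (ENNReal.ofReal (2 ^ a * a / (a - 1)) * (1 + ENNReal.ofReal T))
  have hB : B ≠ ∞ := by finiteness
  refine ⟨ENNReal.ofReal C * (B + B + ENNReal.ofReal T), by finiteness, fun f hfm hf hmod => ?_⟩
  have hq1 : ∀ i, i ≠ 0 → ∀ x, 1 < q i x := fun i hi x => hq.one_lt.trans_le (hq.lower_le i hi x)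
  set D : Fin 3 → Rn n → ℝ≥0∞ := fun i =>
    dyMax (weightMeasure (ω 0)) (majorant (ω 0) (ω i) (q i) (f i) a k) with hD
  have hDm : ∀ i, Measurable (D i) := fun i => measurable_dyMax _ _
  have hDint : ∀ i, i ≠ 0 → ∫⁻ x, D i x ^ 2 ∂weightMeasure (ω 0) ≤ B := by
    intro i hi
    refine (lintegral_dyMax_majorant_sq_le (h.measurable_density 0) (h.measurable_density i)
      (hq.measurable i hi) (hfm i hi) (h.density_pos 0) (h.density_pos i) (hf i hi)
      hq.one_lt k).trans ?_
    exact mul_le_mul_right (mul_le_mul_right (add_le_add (hmod i hi) (hdecay i)) _) _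
  have hbi : ∀ x, biMaxD (fun y => f 1 y * ω 1 y) (fun y => f 2 y * ω 2 y) x ^ r 0 x ≤
      ENNReal.ofReal C * (D 1 x ^ 2 + D 2 x ^ 2 + ENNReal.ofReal (decay k x)) := by
    intro x
    have hr := h.exponent_pos 0 x
    rw [← ENNReal.le_rpow_inv_iff hr]
    refine iSup_le fun Q => iSup₂_le fun hQ hx => ?_
    rw [ENNReal.le_rpow_inv_iff hr]
    refine le_trans (le_of_eq ?_) (hpt f hfm hf hmod Q hQ x hx)
    have hfin : ∀ i, i ≠ 0 → ∫⁻ y in Q.toSet, ENNReal.ofReal (f i y * ω i y) ≠ ∞ := fun i hi =>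
      ne_top_of_le_ne_top ENNReal.ofReal_ne_top (h.lintegral_mul_density_le_norm (hq1 i hi)
        (hq.inv_add_inv i hi) (hf i hi) (hmod i hi) Q)
    have habs : ∀ i, i ≠ 0 → ∀ y, |f i y * ω i y| = f i y * ω i y := fun i hi y =>
      abs_of_nonneg (mul_nonneg (hf i hi y) (h.density_pos i y).le)
    have hV := Q.side_pow_pos
    simp_rw [habs 1 i1, habs 2 i2]
    rw [← ENNReal.ofReal_rpow_of_nonneg (by positivity) hr.le]
    congr 1
    rw [Cube.vol, ← ENNReal.ofReal_toReal (hfin 1 i1), ← ENNReal.ofReal_toReal (hfin 2 i2),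
      ENNReal.toReal_ofReal ENNReal.toReal_nonneg, ENNReal.toReal_ofReal ENNReal.toReal_nonneg,
      ← ENNReal.ofReal_inv_of_pos hV, ← ENNReal.ofReal_mul (by positivity),
      ← ENNReal.ofReal_mul (by positivity), ← ENNReal.ofReal_mul (by positivity)]
    congr 1
    field_simp
  calc _ ≤ ∫⁻ x, ENNReal.ofReal (ω 0 x) *
        (ENNReal.ofReal C * (D 1 x ^ 2 + D 2 x ^ 2 + ENNReal.ofReal (decay k x))) := by
        refine lintegral_mono fun x => ?_
        rw [mul_comm]
        exact mul_le_mul_right (hbi x) _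
    _ = ENNReal.ofReal C * ((∫⁻ x, D 1 x ^ 2 ∂weightMeasure (ω 0)) +
        (∫⁻ x, D 2 x ^ 2 ∂weightMeasure (ω 0)) +
          ∫⁻ x, ENNReal.ofReal (ω 0 x * decay k x)) := by
        have m0 := (h.measurable_density 0).ennreal_ofReal
        have m1 := (hDm 1).pow_const 2
        have m2 := (hDm 2).pow_const 2
        have e1 : Measurable fun x => ENNReal.ofReal (ω 0 x) * D 1 x ^ 2 := m0.mul m1
        have e2 : Measurable fun x => ENNReal.ofReal (ω 0 x) * D 2 x ^ 2 := m0.mul m2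
        have e3 : Measurable fun x => ENNReal.ofReal (ω 0 x) * D 1 x ^ 2 +
            ENNReal.ofReal (ω 0 x) * D 2 x ^ 2 := e1.add e2
        rw [lintegral_weightMeasure (h.measurable_density 0) m1,
          lintegral_weightMeasure (h.measurable_density 0) m2,
          ← lintegral_add_left e1, ← lintegral_add_left e3,
          ← lintegral_const_mul' _ _ ENNReal.ofReal_ne_top]
        refine lintegral_congr fun x => ?_
        rw [ENNReal.ofReal_mul (h.density_pos 0 x).le]
        ring
    _ ≤ _ := by
        gcongr
        · exact hDint 1 i1
        · exact hDint 2 i2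
        · exact hdecay 0

end MuckenhouptTriple

/-! ### From the Muckenhoupt condition to a triple -/

section Norm

variable {n : ℕ} {r : Rn n → ℝ}

theorem eModular_ofExp (hr : ∀ x, 0 ≤ r x) (μ : Measure (Rn n)) (F : Rn n → ℝ≥0∞) (lam : ℝ≥0∞) :
    eModular (ofExp r) μ F lam = ∫⁻ x, (F x / lam) ^ r x ∂μ := by
  have h1 : {x | ofExp r x ≠ ∞} = univ := by ext x; simp [ofExp]
  have h2 : {x | ofExp r x = ∞} = ∅ := by ext x; simp [ofExp]
  rw [eModular, h1, h2, Measure.restrict_empty, essSup_measure_zero, bot_eq_zero, add_zero,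
    Measure.restrict_univ]
  refine lintegral_congr fun x => ?_
  rw [ofExp, ENNReal.toReal_ofReal (hr x)]

theorem vNorm_congr_ae (hr : ∀ x, 0 ≤ r x) {f g : Rn n → ℝ} (h : f =ᵐ[volume] g) :
    vNorm (ofExp r) f = vNorm (ofExp r) g := by
  have : ∀ lam, eModular (ofExp r) volume (fun x => ENNReal.ofReal |f x|) lam =
      eModular (ofExp r) volume (fun x => ENNReal.ofReal |g x|) lam := by
    intro lam
    rw [eModular_ofExp hr, eModular_ofExp hr]
    refine lintegral_congr_ae ?_
    filter_upwards [h] with x hx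
    rw [hx]
  simp_rw [vNorm, eNorm, this]

theorem eModular_indicator (hr : ∀ x, 0 < r x) {g : Rn n → ℝ} (hg : ∀ x, 0 < g x) (Q : Cube n)
    (lam : ℝ≥0∞) :
    eModular (ofExp r) volume (fun x => ENNReal.ofReal |Q.toSet.indicator g x|) lam =
      ∫⁻ x in Q.toSet, (ENNReal.ofReal (g x) / lam) ^ r x := by
  rw [eModular_ofExp fun x => (hr x).le, ← lintegral_indicator Q.measurableSet_toSet]
  refine lintegral_congr fun x => ?_
  by_cases hx : x ∈ Q.toSet
  · rw [indicator_of_mem hx, indicator_of_mem hx, abs_of_pos (hg x)]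
  · rw [indicator_of_notMem hx, indicator_of_notMem hx, abs_zero, ENNReal.ofReal_zero,
      ENNReal.zero_div, ENNReal.zero_rpow_of_pos (hr x)]

theorem vNorm_indicator_ne_zero {m : ℝ} (hm : 0 < m) (hmr : ∀ x, m ≤ r x) (hrm : Measurable r)
    {g : Rn n → ℝ} (hgm : Measurable g) (hg : ∀ x, 0 < g x) (Q : Cube n) :
    vNorm (ofExp r) (Q.toSet.indicator g) ≠ 0 := by
  have hr : ∀ x, 0 < r x := fun x => hm.trans_le (hmr x)
  intro h0
  set S := ∫⁻ x in Q.toSet, ENNReal.ofReal (g x) ^ r x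
  have hS : 0 < S := by
    rw [setLIntegral_pos_iff (hgm.ennreal_ofReal.pow hrm)]
    have : Function.support (fun x => ENNReal.ofReal (g x) ^ r x) = univ := by
      ext x
      simp [ENNReal.rpow_eq_zero_iff, hg x, (hr x).not_gt]
    rw [this, univ_inter, Q.volume_toSet]
    simpa using Q.side_pow_pos
  have hlt : vNorm (ofExp r) (Q.toSet.indicator g) < min 1 (S ^ m⁻¹) := by
    rw [h0]
    exact lt_min one_pos (ENNReal.rpow_pos_of_nonneg hS (inv_pos.2 hm).le)
  obtain ⟨lam, ⟨hl0, hl⟩, hlam⟩ := sInf_lt_iff.1 hlt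
  rw [eModular_indicator hr hg] at hl
  have hl1 : lam ≤ 1 := (hlam.trans_le (min_le_left _ _)).le
  have hlS : lam ^ m < S := by
    rw [← ENNReal.lt_rpow_inv_iff hm]
    exact hlam.trans_le (min_le_right _ _)
  have hlt : lam ≠ ∞ := ne_top_of_le_ne_top ENNReal.one_ne_top hl1
  have hlm : (lam⁻¹) ^ m ≠ ∞ := ENNReal.rpow_ne_top_of_nonneg hm.le (ENNReal.inv_ne_top.2 hl0)
  have : (lam⁻¹) ^ m * S ≤ 1 := by
    rw [← lintegral_const_mul' _ _ hlm]
    refine le_trans (lintegral_mono fun x => ?_) hl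
    rw [div_eq_mul_inv, ENNReal.mul_rpow_of_nonneg _ _ (hr x).le, mul_comm]
    gcongr
    · rwa [ENNReal.one_le_inv]
    · exact hmr x
  rw [ENNReal.inv_rpow, ENNReal.inv_mul_le_iff (by simp [hl0, hlt]) (by simp [hl0, hlt]),
    mul_one] at this
  exact this.not_gt hlS

theorem lintegral_normalized_le_one (hr : ∀ x, 0 < r x) {g : Rn n → ℝ} (hg : ∀ x, 0 < g x)
    (Q : Cube n) {t : ℝ} (ht : 0 < t)
    (hlt : vNorm (ofExp r) (Q.toSet.indicator g) < ENNReal.ofReal t) :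
    ∫⁻ x in Q.toSet, ENNReal.ofReal (t ^ (-r x) * g x ^ r x) ≤ 1 := by
  obtain ⟨lam, ⟨hl0, hl⟩, hlam⟩ := sInf_lt_iff.1 hlt
  rw [eModular_indicator hr hg] at hl
  refine le_trans (lintegral_mono fun x => ?_) hl
  have hgx := hg x
  rw [Real.rpow_neg ht.le, ← div_eq_inv_mul, ← Real.div_rpow hgx.le ht.le,
    ← ENNReal.ofReal_rpow_of_pos (by positivity), ENNReal.ofReal_div_of_pos ht]
  have := (hr x).le
  gcongr

/-- The bilinear Muckenhoupt condition for positive weights yields a triple. -/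
theorem exists_muckenhouptTriple {r g : Fin 3 → Rn n → ℝ} {m M : ℝ} (hm : 0 < m)
    (hrm : ∀ i, Measurable (r i)) (hgm : ∀ i, Measurable (g i)) (hg : ∀ i x, 0 < g i x)
    (hmr : ∀ i x, m ≤ r i x) (hrM : ∀ i x, r i x ≤ M) (hsum : ∀ x, ∑ i, (r i x)⁻¹ = 2)
    (hprod : ∀ x, ∏ i, g i x = 1) (hlog : ∀ i, LogRegular (r i)) {C : ℝ≥0∞} (hC : C ≠ ∞)
    (hA : ∀ Q : Cube n, Q.vol⁻¹ ^ 2 * ∏ i, vNorm (ofExp (r i)) (Q.toSet.indicator (g i)) ≤ C) :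
    ∃ (N : Fin 3 → Cube n → ℝ) (K : ℝ),
      MuckenhouptTriple r (fun i x => g i x ^ r i x) N m M K := by
  have hr : ∀ i x, 0 < r i x := fun i x => hm.trans_le (hmr i x)
  set ν : Fin 3 → Cube n → ℝ≥0∞ := fun i Q => vNorm (ofExp (r i)) (Q.toSet.indicator (g i)) with hν
  have hν0 : ∀ i Q, ν i Q ≠ 0 := fun i Q =>
    vNorm_indicator_ne_zero hm (hmr i) (hrm i) (hgm i) (hg i) Q
  have hprodle : ∀ Q : Cube n, ∏ i, ν i Q ≤ C * ENNReal.ofReal (Q.side ^ n) ^ 2 := by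
    intro Q
    have hV := Q.side_pow_pos
    have := hA Q
    rwa [Cube.vol, ← ENNReal.inv_pow, ENNReal.inv_mul_le_iff (by simpa using hV) (by finiteness),
      mul_comm] at this
  have hνt : ∀ i Q, ν i Q ≠ ∞ := by
    intro i Q hi
    have h1 : ∏ i, ν i Q = ∞ := by
      rw [← Finset.mul_prod_erase _ _ (Finset.mem_univ i), hi, ENNReal.top_mul]
      exact Finset.prod_ne_zero_iff.2 fun j _ => hν0 j Q
    have h2 := hprodle Q
    rw [h1, top_le_iff] at h2
    exact (by finiteness : C * ENNReal.ofReal (Q.side ^ n) ^ 2 ≠ ∞) h2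
  have hνpos : ∀ i Q, 0 < (ν i Q).toReal := fun i Q => ENNReal.toReal_pos (hν0 i Q) (hνt i Q)
  refine ⟨fun i Q => 2 * (ν i Q).toReal, max 1 (8 * C.toReal), ?_⟩
  exact
    { measurable_exponent := hrm
      measurable_density := fun i => (hgm i).pow (hrm i)
      density_pos := fun i x => Real.rpow_pos_of_pos (hg i x) _
      lower_pos := hm
      lower_le := hmr
      le_upper := hrM
      sum_inv := hsum
      prod_rpow := fun x => by
        rw [← hprod x]
        refine Finset.prod_congr rfl fun i _ => ?_
        rw [← Real.rpow_mul (hg i x).le, mul_inv_cancel₀ (hr i x).ne', Real.rpow_one]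
      norm_pos := fun i Q => mul_pos two_pos (hνpos i Q)
      modular_le := fun i Q => by
        have hN := hνpos i Q
        refine lintegral_normalized_le_one (hr i) (hg i) Q (by positivity) ?_
        rw [ENNReal.lt_ofReal_iff_toReal_lt (hνt i Q)]
        linarith
      one_le_const := le_max_left _ _
      prod_le := fun Q => by
        have hV := Q.side_pow_pos
        have h1 := ENNReal.toReal_mono (by finiteness) (hprodle Q)
        rw [ENNReal.toReal_prod, ENNReal.toReal_mul, ENNReal.toReal_pow,
          ENNReal.toReal_ofReal hV.le] at h1
        rw [Finset.prod_mul_distrib]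
        calc _ ≤ (∏ i : Fin 3, (2 : ℝ)) * (C.toReal * (Q.side ^ n) ^ 2) := by gcongr
          _ = 8 * C.toReal * (Q.side ^ n) ^ 2 := by norm_num; ring
          _ ≤ _ := by gcongr; exact le_max_right _ _
      logRegular := hlog }

theorem conjExp_eq_ofExp {p : Rn n → ℝ} (hp : ∀ x, 1 < p x) :
    conjExp p = ofExp fun x => p x / (p x - 1) := by
  funext x
  have h := hp x
  rw [conjExp, econj, ofExp, if_neg (by simpa using h.ne'), if_neg ENNReal.ofReal_ne_top,
    ENNReal.toReal_ofReal (by linarith)]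

theorem biMaxD_congr_ae {f₁ f₂ g₁ g₂ : Rn n → ℝ} (h₁ : f₁ =ᵐ[volume] g₁)
    (h₂ : f₂ =ᵐ[volume] g₂) : biMaxD f₁ f₂ = biMaxD g₁ g₂ := by
  have key : ∀ {f g : Rn n → ℝ}, f =ᵐ[volume] g → ∀ Q : Cube n,
      ∫⁻ y in Q.toSet, ENNReal.ofReal |f y| = ∫⁻ y in Q.toSet, ENNReal.ofReal |g y| := by
    intro f g h Q
    refine lintegral_congr_ae (ae_restrict_of_ae ?_)
    filter_upwards [h] with x hx
    rw [hx]
  funext x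
  simp_rw [biMaxD, key h₁, key h₂]

end Norm

theorem forall_fin_three {P : Fin 3 → Prop} (h0 : P 0) (h1 : P 1) (h2 : P 2) : ∀ i, P i := by
  intro i
  fin_cases i
  exacts [h0, h1, h2]

section Main

variable {n : ℕ}

theorem inv_add_inv_conjugate {t : ℝ} (ht : 1 < t) : t⁻¹ + (t / (t - 1))⁻¹ = 1 := by
  have : t ≠ 0 := by linarith
  field_simp
  ring

/-- A weight agrees almost everywhere with an everywhere positive one. -/
theorem IsWeight.exists_pos {w : Rn n → ℝ} (hw : IsWeight w) :
    ∃ v : Rn n → ℝ, Measurable v ∧ (∀ x, 0 < v x) ∧ v =ᵐ[volume] w := by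
  refine ⟨fun x => if 0 < w x then w x else 1, ?_, fun x => ?_, ?_⟩
  · exact Measurable.ite (measurableSet_lt measurable_const hw.1) hw.1 measurable_const
  · dsimp only
    split_ifs with h
    exacts [h, one_pos]
  · filter_upwards [hw.2] with x hx
    rw [if_pos hx]

/-- Properties of the conjugate of a log-Hölder exponent bounded away from `1`. -/
theorem conjugate_properties {p : Rn n → ℝ} {a : ℝ} (ha : 1 < a) (hpa : ∀ x, a ≤ p x)
    (hp : LogRegular fun x => (p x)⁻¹) : (∀ x, 1 ≤ p x / (p x - 1)) ∧
      (∀ x, p x / (p x - 1) ≤ (1 - a⁻¹)⁻¹) ∧ LogRegular fun x => p x / (p x - 1) := by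
  have e : ∀ x, p x / (p x - 1) = (1 - (p x)⁻¹)⁻¹ := fun x => by
    have h1 := hpa x
    rw [← inv_inj, inv_inv, inv_div, sub_div, div_self (by linarith), one_div]
  have ha' : a⁻¹ < 1 := inv_lt_one_of_one_lt₀ ha
  have hle : ∀ x, 1 - a⁻¹ ≤ 1 - (p x)⁻¹ := fun x =>
    sub_le_sub_left (inv_anti₀ (by linarith) (hpa x)) _
  refine ⟨fun x => ?_, fun x => ?_, ?_⟩
  · have h1 := hpa x
    rw [one_le_div (by linarith)]
    linarith
  · rw [e]
    exact inv_anti₀ (by linarith) (hle x)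
  · simp_rw [e]
    exact (hp.const_sub 1).inv (by linarith) hle

end Main

/-- the key modular estimate
`∫ M^d(f₁σ₁,f₂σ₂)^{p(x)} u dx ≲ 1` for normalized `f₁, f₂`. -/
theorem statement11 {n : ℕ} (p₁ p₂ p w₁ w₂ w u σ₁ σ₂ : Rn n → ℝ)
    (hp₁m : Measurable p₁) (hp₂m : Measurable p₂)
    (hp₁1 : ∀ x, 1 ≤ p₁ x) (hp₂1 : ∀ x, 1 ≤ p₂ x)
    (hp₁b : ∃ a b : ℝ, 1 < a ∧ ∀ᵐ x ∂(volume : Measure (Rn n)), a ≤ p₁ x ∧ p₁ x ≤ b)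
    (hp₂b : ∃ a b : ℝ, 1 < a ∧ ∀ᵐ x ∂(volume : Measure (Rn n)), a ≤ p₂ x ∧ p₂ x ≤ b)
    (hp₁LH : LH p₁) (hp₂LH : LH p₂)
    (hp : ∀ x, 1 / p x = 1 / p₁ x + 1 / p₂ x)
    (hw₁ : IsWeight w₁) (hw₂ : IsWeight w₂)
    (hw : ∀ x, w x = w₁ x * w₂ x)
    (hA : ApVec p₁ p₂ p w₁ w₂ w)
    (hu : ∀ x, u x = w x ^ p x)
    (hσ₁ : ∀ x, σ₁ x = w₁ x ^ (-(p₁ x / (p₁ x - 1))))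
    (hσ₂ : ∀ x, σ₂ x = w₂ x ^ (-(p₂ x / (p₂ x - 1)))) :
    ∃ C : ℝ≥0∞, C ≠ ∞ ∧ ∀ f₁ f₂ : Rn n → ℝ, Measurable f₁ → Measurable f₂ →
      (∀ x, 0 ≤ f₁ x) → (∀ x, 0 ≤ f₂ x) →
      (∃ B : ℝ, ∀ x, f₁ x ≤ B) → (∃ B : ℝ, ∀ x, f₂ x ≤ B) →
      HasCompactSupport f₁ → HasCompactSupport f₂ →
      (∫⁻ x, ENNReal.ofReal (f₁ x ^ p₁ x * σ₁ x)) ≤ 1 →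
      (∫⁻ x, ENNReal.ofReal (f₂ x ^ p₂ x * σ₂ x)) ≤ 1 →
      ∫⁻ x, biMaxD (fun y => f₁ y * σ₁ y) (fun y => f₂ y * σ₂ y) x ^ p x *
          ENNReal.ofReal (u x) ≤ C := by
  obtain ⟨a₁, b₁, ha₁, hb₁⟩ := hp₁b
  obtain ⟨a₂, b₂, ha₂, hb₂⟩ := hp₂b
  have k₁ := hp₁LH.1.forall_of_ae hp₁1 ha₁ hb₁
  have k₂ := hp₂LH.1.forall_of_ae hp₂1 ha₂ hb₂
  set a := min a₁ a₂
  set b := max b₁ b₂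
  have ha : 1 < a := lt_min ha₁ ha₂
  have hp₁a : ∀ x, a ≤ p₁ x := fun x => (min_le_left _ _).trans (k₁ x).1
  have hp₂a : ∀ x, a ≤ p₂ x := fun x => (min_le_right _ _).trans (k₂ x).1
  have hp₁b : ∀ x, p₁ x ≤ b := fun x => (k₁ x).2.trans (le_max_left _ _)
  have hp₂b : ∀ x, p₂ x ≤ b := fun x => (k₂ x).2.trans (le_max_right _ _)
  have hp₁pos : ∀ x, 0 < (p₁ x)⁻¹ := fun x => inv_pos.2 (zero_lt_one.trans_le (hp₁1 x))
  have hp₂pos : ∀ x, 0 < (p₂ x)⁻¹ := fun x => inv_pos.2 (zero_lt_one.trans_le (hp₂1 x))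
  have hb : ∀ x, b⁻¹ ≤ (p₁ x)⁻¹ := fun x => inv_anti₀ (inv_pos.1 (hp₁pos x)) (hp₁b x)
  have hbpos : 0 < b⁻¹ := inv_pos.2 (zero_lt_one.trans_le ((hp₁1 0).trans (hp₁b 0)))
  have hinv : ∀ x, (p x)⁻¹ = (p₁ x)⁻¹ + (p₂ x)⁻¹ := by simpa using hp
  have hpinv : p = fun x => ((p₁ x)⁻¹ + (p₂ x)⁻¹)⁻¹ := by
    funext x
    rw [← hinv, inv_inv]
  have hpm : Measurable p := hpinv ▸ (hp₁m.inv.add hp₂m.inv).inv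
  have hppos : ∀ x, 0 < p x := fun x => by
    rw [← inv_pos, hinv]
    exact add_pos (hp₁pos x) (hp₂pos x)
  have hpl : ∀ x, 1 / 2 ≤ p x := fun x => by
    rw [one_div, inv_le_comm₀ two_pos (hppos x), hinv]
    linarith [inv_le_one_of_one_le₀ (hp₁1 x), inv_le_one_of_one_le₀ (hp₂1 x)]
  have hpu : ∀ x, p x ≤ b := fun x => by
    rw [← inv_le_inv₀ (inv_pos.1 hbpos) (hppos x), hinv]
    linarith [hb x, hp₂pos x]
  have hlog₁ := hp₁LH.logRegular_inv
  have hlog₂ := hp₂LH.logRegular_inv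
  have hlog : LogRegular p := by
    rw [hpinv]
    exact (hlog₁.add hlog₂).inv hbpos fun x => by linarith [hb x, hp₂pos x]
  have hlogq : ∀ s : Rn n → ℝ, (LogRegular fun x => (s x)⁻¹) → (∀ x, 1 ≤ s x) →
      (∀ x, s x ≤ b) → LogRegular s := by
    intro s hs h1 h2
    simpa using hs.inv hbpos fun x => inv_anti₀ (zero_lt_one.trans_le (h1 x)) (h2 x)
  obtain ⟨c₁, d₁, e₁⟩ := conjugate_properties ha hp₁a hlog₁
  obtain ⟨c₂, d₂, e₂⟩ := conjugate_properties ha hp₂a hlog₂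
  obtain ⟨v₁, v₁m, v₁pos, v₁ae⟩ := hw₁.exists_pos
  obtain ⟨v₂, v₂m, v₂pos, v₂ae⟩ := hw₂.exists_pos
  obtain ⟨C, hC, hA⟩ := hA
  have i₁ : ∀ x, (p₁ x)⁻¹ + (p₁ x / (p₁ x - 1))⁻¹ = 1 := fun x =>
    inv_add_inv_conjugate (ha.trans_le (hp₁a x))
  have i₂ : ∀ x, (p₂ x)⁻¹ + (p₂ x / (p₂ x - 1))⁻¹ = 1 := fun x =>
    inv_add_inv_conjugate (ha.trans_le (hp₂a x))
  obtain ⟨N, K, h⟩ := exists_muckenhouptTriple (n := n) (m := 1 / 2)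
    (M := max b (1 - a⁻¹)⁻¹) (C := C)
    (r := ![p, fun x => p₁ x / (p₁ x - 1), fun x => p₂ x / (p₂ x - 1)])
    (g := ![fun x => v₁ x * v₂ x, fun x => (v₁ x)⁻¹, fun x => (v₂ x)⁻¹])
    (by norm_num)
    (forall_fin_three hpm (hp₁m.div (hp₁m.sub_const 1)) (hp₂m.div (hp₂m.sub_const 1)))
    (forall_fin_three (v₁m.mul v₂m) v₁m.inv v₂m.inv)
    (forall_fin_three (fun x => mul_pos (v₁pos x) (v₂pos x)) (fun x => inv_pos.2 (v₁pos x))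
      fun x => inv_pos.2 (v₂pos x))
    (forall_fin_three hpl (fun x => le_trans (by norm_num) (c₁ x))
      fun x => le_trans (by norm_num) (c₂ x))
    (forall_fin_three (fun x => (hpu x).trans (le_max_left _ _))
      (fun x => (d₁ x).trans (le_max_right _ _)) fun x => (d₂ x).trans (le_max_right _ _))
    (fun x => by
      rw [Fin.sum_univ_three]
      change (p x)⁻¹ + (p₁ x / (p₁ x - 1))⁻¹ + (p₂ x / (p₂ x - 1))⁻¹ = 2
      linarith [hinv x, i₁ x, i₂ x])
    (fun x => by
      rw [Fin.prod_univ_three]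
      change v₁ x * v₂ x * (v₁ x)⁻¹ * (v₂ x)⁻¹ = 1
      have := v₁pos x
      have := v₂pos x
      field_simp)
    (forall_fin_three hlog e₁ e₂) hC
    (fun Q => by
      rw [Fin.prod_univ_three]
      change Q.vol⁻¹ ^ 2 * (vNorm (ofExp p) (Q.toSet.indicator fun x => v₁ x * v₂ x) *
        vNorm (ofExp fun x => p₁ x / (p₁ x - 1)) (Q.toSet.indicator fun x => (v₁ x)⁻¹) *
        vNorm (ofExp fun x => p₂ x / (p₂ x - 1)) (Q.toSet.indicator fun x => (v₂ x)⁻¹)) ≤ C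
      refine le_trans (le_of_eq ?_) (hA Q)
      rw [conjExp_eq_ofExp fun x => ha.trans_le (hp₁a x),
        conjExp_eq_ofExp fun x => ha.trans_le (hp₂a x), ← mul_assoc, ← mul_assoc]
      congr 1
      · congr 1
        · congr 1
          refine vNorm_congr_ae (fun x => (hppos x).le) ?_
          filter_upwards [v₁ae, v₂ae] with x h1 h2
          simp only [indicator, hw, h1, h2]
        · refine vNorm_congr_ae (fun x => zero_le_one.trans (c₁ x)) ?_
          filter_upwards [v₁ae] with x h1
          simp only [indicator, h1]
      · refine vNorm_congr_ae (fun x => zero_le_one.trans (c₂ x)) ?_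
        filter_upwards [v₂ae] with x h2
        simp only [indicator, h2])
  have hq : ConjugateExponents ![p, fun x => p₁ x / (p₁ x - 1), fun x => p₂ x / (p₂ x - 1)]
      ![p, p₁, p₂] a b :=
    { one_lt := ha
      measurable := forall_fin_three (fun h0 => absurd rfl h0) (fun _ => hp₁m) fun _ => hp₂m
      logRegular := forall_fin_three (fun h0 => absurd rfl h0)
        (fun _ => hlogq p₁ hlog₁ hp₁1 hp₁b) fun _ => hlogq p₂ hlog₂ hp₂1 hp₂b
      lower_le := forall_fin_three (fun h0 => absurd rfl h0) (fun _ => hp₁a) fun _ => hp₂a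
      le_upper := forall_fin_three (fun h0 => absurd rfl h0) (fun _ => hp₁b) fun _ => hp₂b
      inv_add_inv := forall_fin_three (fun h0 => absurd rfl h0) (fun _ => i₁) fun _ => i₂ }
  obtain ⟨C', hC', hbound⟩ := h.exists_lintegral_biMaxD_rpow_le hq
  refine ⟨C', hC', fun f₁ f₂ hf₁m hf₂m hf₁ hf₂ _ _ _ _ hmod₁ hmod₂ => ?_⟩
  have s₁ : (fun x => (v₁ x)⁻¹ ^ (p₁ x / (p₁ x - 1))) =ᵐ[volume] σ₁ := by
    filter_upwards [v₁ae] with x h1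
    rw [hσ₁, ← h1, Real.inv_rpow (v₁pos x).le, Real.rpow_neg (v₁pos x).le]
  have s₂ : (fun x => (v₂ x)⁻¹ ^ (p₂ x / (p₂ x - 1))) =ᵐ[volume] σ₂ := by
    filter_upwards [v₂ae] with x h2
    rw [hσ₂, ← h2, Real.inv_rpow (v₂pos x).le, Real.rpow_neg (v₂pos x).le]
  have hfin := hbound ![0, f₁, f₂]
    (forall_fin_three (fun h0 => absurd rfl h0) (fun _ => hf₁m) fun _ => hf₂m)
    (forall_fin_three (fun h0 => absurd rfl h0) (fun _ => hf₁) fun _ => hf₂)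
    (forall_fin_three (fun h0 => absurd rfl h0)
      (fun _ => le_trans (le_of_eq (lintegral_congr_ae (by
        filter_upwards [s₁] with x hx
        rw [← hx]
        rfl))) hmod₁)
      (fun _ => le_trans (le_of_eq (lintegral_congr_ae (by
        filter_upwards [s₂] with x hx
        rw [← hx]
        rfl))) hmod₂))
  refine le_trans (le_of_eq (lintegral_congr_ae ?_)) hfin
  rw [biMaxD_congr_ae (g₁ := fun y => f₁ y * (v₁ y)⁻¹ ^ (p₁ y / (p₁ y - 1)))
    (g₂ := fun y => f₂ y * (v₂ y)⁻¹ ^ (p₂ y / (p₂ y - 1)))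
    (by filter_upwards [s₁] with x hx; rw [hx]) (by filter_upwards [s₂] with x hx; rw [hx])]
  filter_upwards [v₁ae, v₂ae] with x h1 h2
  rw [hu, hw, ← h1, ← h2]
  rfl
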